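/- arXiv:2511.02316 — 3 statements merged into one kernel-verified Lean document; each statement's English description precedes it below -/
import Mathlib

section
/- Let ε ∈ (0,1) satisfy (1 + δ)(1 - ε)^2 > 1 + δ/2, and fix ρ > 0 with ρδ/2 > 1 + δ. Then there exists a constant C > 0 such that for all sufficiently large n, P(F_{(n+1)^ρ, n^ρ} > 0) ≤ C n^{-(1+δ)}. -/
open MeasureTheory ProbabilityTheory Filter Set
open scoped ENNReal NNReal

variable {Ω : Type*}

/-- Partial sums of the steps: `S X n = X 0 + ⋯ + X (n-1)` (the walk started at `0`). -/
noncomputable def S (X : ℕ → Ω → ℤ) (n : ℕ) (ω : Ω) : ℤ :=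
  ∑ i ∈ Finset.range n, X i ω

/-- The local time at site `z` up to time `n`: `ξ(z,n) = #{k : 0 < k ≤ n, S_k = z}`. -/
noncomputable def localTime (X : ℕ → Ω → ℤ) (z : ℤ) (n : ℕ) (ω : Ω) : ℕ :=
  ((Finset.Icc 1 n).filter (fun k => S X k ω = z)).card

/-- The maximal local time `ξ(n) = max_{y ∈ ℤ} ξ(y,n)`. -/
noncomputable def maxLocalTime (X : ℕ → Ω → ℤ) (n : ℕ) (ω : Ω) : ℕ :=
  sSup (Set.range fun z : ℤ => localTime X z n ω)

/-- The set of favorite sites at time `n`: `K(n) = {z : ξ(z,n) = ξ(n)}`. -/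
noncomputable def favSites (X : ℕ → Ω → ℤ) (n : ℕ) (ω : Ω) : Set ℤ :=
  {z : ℤ | localTime X z n ω = maxLocalTime X n ω}

/-- The total local time at site `z`: `ξ(z,∞) = #{k > 0 : S_k = z}` (as an extended natural). -/
noncomputable def totalLocalTime (X : ℕ → Ω → ℤ) (z : ℤ) (ω : Ω) : ℕ∞ :=
  {k : ℕ | 0 < k ∧ S X k ω = z}.encard

/-- `X` is a sequence of i.i.d. steps with `P(X_i = 1) = p`, `P(X_i = -1) = q`. -/
def IsAsymmetricSRW [MeasurableSpace Ω] (P : Measure Ω) (X : ℕ → Ω → ℤ) (p q : ℝ) : Prop :=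
  (∀ i, Measurable (X i)) ∧
  iIndepFun X P ∧
  (∀ i, P {ω | X i ω = 1} = ENNReal.ofReal p) ∧
  (∀ i, P {ω | X i ω = -1} = ENNReal.ofReal q)

open scoped Classical in
/-- The pair count `F_{a,b}`: the number of pairs `1 ≤ i < j ≤ ⌊a⌋` with
`j ≤ (i + 2λ log a) ∧ ⌊a⌋`, such that both `S_i` and `S_j` have local time at least
`(1-ε) λ log b` at time `⌊a⌋`, neither `S_i` nor `S_j` occurs strictly between times
`i` and `j`, and `S_i ≠ S_j`.  Here `λ = -1/log(2q)`. -/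
noncomputable def Fcount (q : ℝ) (X : ℕ → Ω → ℤ) (ε : ℝ) (a b : ℝ) (ω : Ω) : ℕ :=
  ∑ i ∈ Finset.Icc 1 ⌊a⌋₊,
    ∑ j ∈ Finset.Icc (i + 1) (min ⌊(i : ℝ) + 2 * (-1 / Real.log (2*q)) * Real.log a⌋₊ ⌊a⌋₊),
      if ((1 - ε) * (-1 / Real.log (2*q)) * Real.log b
            ≤ min (localTime X (S X i ω) ⌊a⌋₊ ω : ℝ) (localTime X (S X j ω) ⌊a⌋₊ ω)
          ∧ (∀ l : ℕ, i < l → l < j → S X l ω ≠ S X i ω ∧ S X l ω ≠ S X j ω)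
          ∧ S X i ω ≠ S X j ω) then 1 else 0

/-- The event `D_n^ε = {(1-ε/2) λ log n ≤ ξ(n) ≤ 2(1+ε/2) λ log n}`. -/
noncomputable def Dset (q : ℝ) (X : ℕ → Ω → ℤ) (ε : ℝ) (n : ℕ) : Set Ω :=
  {ω | (1 - ε/2) * (-1 / Real.log (2*q)) * Real.log n ≤ (maxLocalTime X n ω : ℝ)
        ∧ (maxLocalTime X n ω : ℝ) ≤ 2 * (1 + ε/2) * (-1 / Real.log (2*q)) * Real.log n}

/-- The event `E_n^ε = {F_n = 0}`, i.e. there is no pair of nearby thick points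
before time `n`. -/
noncomputable def Eset (q : ℝ) (X : ℕ → Ω → ℤ) (ε : ℝ) (n : ℕ) : Set Ω :=
  {ω | Fcount q X ε (n : ℝ) (n : ℝ) ω = 0}

section helpers

/-- the one-site potential -/
noncomputable def gpot (h : ℝ) (z : ℤ) : ℝ := h ^ z.toNat

lemma gpot_nonneg {h : ℝ} (h0 : 0 ≤ h) (z : ℤ) : 0 ≤ gpot h z := pow_nonneg h0 _

lemma gpot_le_one {h : ℝ} (h0 : 0 ≤ h) (h1 : h ≤ 1) (z : ℤ) : gpot h z ≤ 1 :=
  pow_le_one₀ h0 h1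

lemma gpot_neg {h : ℝ} {z : ℤ} (hz : z ≤ 0) : gpot h z = 1 := by
  simp [gpot, Int.toNat_of_nonpos hz]

lemma gpot_pos_le {h : ℝ} (h0 : 0 ≤ h) (h1 : h ≤ 1) {z : ℤ} (hz : 0 < z) : gpot h z ≤ h := by
  unfold gpot
  calc h ^ z.toNat ≤ h ^ 1 := pow_le_pow_of_le_one h0 h1 (by omega)
    _ = h := pow_one h

lemma gpot_harm {p q : ℝ} (hp : 0 < p) (hpq : p + q = 1) {z : ℤ} (hz : z ≠ 0) :
    p * gpot (q/p) (z+1) + q * gpot (q/p) (z-1) = gpot (q/p) z := by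
  rcases lt_or_gt_of_ne hz with h | h
  · rw [gpot_neg (by omega), gpot_neg (by omega), gpot_neg (by omega)]; linarith
  · obtain ⟨k, rfl⟩ : ∃ k : ℕ, z = k + 1 := ⟨(z-1).toNat, by omega⟩
    have e1 : ((k:ℤ) + 1 + 1).toNat = k + 2 := by omega
    have e2 : ((k:ℤ) + 1 - 1).toNat = k := by omega
    have e3 : ((k:ℤ) + 1).toNat = k + 1 := by omega
    simp only [gpot, e1, e2, e3]
    have : p * (q/p) = q := by field_simp
    have h2 : p * (q/p)^2 + q = q/p := by
      field_simp
      have : p = 1 - q := by linarith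
      subst this; ring
    calc p * (q/p)^(k+2) + q * (q/p)^k = (q/p)^k * (p * (q/p)^2 + q) := by ring
      _ = _ := by rw [h2]; ring

lemma gpot_zero {p q : ℝ} (hp : 0 < p) :
    p * gpot (q/p) (0+1) + q * gpot (q/p) (0-1) = 2 * q := by
  have e1 : ((0:ℤ) + 1).toNat = 1 := by omega
  have e2 : ((0:ℤ) - 1).toNat = 0 := by omega
  simp only [gpot, e1, e2]
  field_simp; ring

/-- the two-site potential -/
noncomputable def vpot (h η : ℝ) (x y : ℤ) (z : ℤ) : ℝ :=
  η + gpot h (z - x) + Real.sqrt h * gpot h (z - y)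

lemma vpot_ge {h η : ℝ} (h0 : 0 ≤ h) (x y z : ℤ) : η ≤ vpot h η x y z := by
  unfold vpot
  have := gpot_nonneg h0 (z-x)
  have := mul_nonneg (Real.sqrt_nonneg h) (gpot_nonneg h0 (z-y))
  linarith

lemma vpot_le {h η : ℝ} (h0 : 0 ≤ h) (h1 : h ≤ 1) (x y z : ℤ) : vpot h η x y z ≤ η + 2 := by
  unfold vpot
  have a := gpot_le_one h0 h1 (z-x)
  have b := gpot_le_one h0 h1 (z-y)
  have c : Real.sqrt h ≤ 1 := Real.sqrt_le_one.mpr h1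
  have := mul_le_one₀ c (gpot_nonneg h0 (z-y)) b
  linarith

lemma vpot_off {p q η : ℝ} (hp : 0 < p) (hpq : p + q = 1) {x y z : ℤ} (hx : z ≠ x) (hy : z ≠ y) :
    p * vpot (q/p) η x y (z+1) + q * vpot (q/p) η x y (z-1) = vpot (q/p) η x y z := by
  have a := gpot_harm hp hpq (sub_ne_zero.mpr hx)
  have b := gpot_harm hp hpq (sub_ne_zero.mpr hy)
  unfold vpot
  rw [show z + 1 - x = z - x + 1 by ring, show z - 1 - x = z - x - 1 by ring,
    show z + 1 - y = z - y + 1 by ring, show z - 1 - y = z - y - 1 by ring]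
  rw [← a, ← b]
  have : p = 1 - q := by linarith
  subst this
  ring

lemma vpot_on {p q η γ : ℝ} (hq0 : 0 < q) (hq : q < 1/2) (hpq : p + q = 1)
    (hγ : (2*q + Real.sqrt (q/p)) / (1 + Real.sqrt (q/p)) < γ) (hγ1 : γ < 1)
    (hη : η * (1 - γ) =
      (γ - (2*q + Real.sqrt (q/p)) / (1 + Real.sqrt (q/p))) * Real.sqrt (q/p))
    {x y z : ℤ} (hxy : x < y) (hz : z = x ∨ z = y) :
    p * vpot (q/p) η x y (z+1) + q * vpot (q/p) η x y (z-1) ≤ γ * vpot (q/p) η x y z := by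
  have hp : 0 < p := by linarith
  have h0 : 0 < q/p := by positivity
  have h1 : q/p ≤ 1 := by rw [div_le_one hp]; linarith
  set r := Real.sqrt (q/p) with hr
  have hr0 : 0 < r := Real.sqrt_pos.mpr h0
  have hrr : r * r = q/p := Real.mul_self_sqrt h0.le
  set α := (2*q + r) / (1 + r) with hα
  have hαe : α * (1 + r) = 2*q + r := by rw [hα]; field_simp
  -- suffices with u
  have key : ∀ u : ℝ, r ≤ u → η + α * u ≤ γ * (η + u) := by
    intro u hu
    have : (γ - α) * r ≤ (γ - α) * u := mul_le_mul_of_nonneg_left hu (by linarith)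
    nlinarith
  rcases hz with rfl | rfl
  · have b := gpot_harm hp hpq (sub_ne_zero.mpr hxy.ne)
    have a := gpot_zero (q := q) hp
    have k := key (1 + r) (by linarith)
    have hy1 : gpot (q/p) (z - y) = 1 := gpot_neg (by omega)
    have hx1 : gpot (q/p) (z - z) = 1 := gpot_neg (by omega)
    have e : p * vpot (q/p) η z y (z+1) + q * vpot (q/p) η z y (z-1) = η + 2*q + r := by
      unfold vpot
      rw [show z + 1 - z = 0 + 1 by ring, show z - 1 - z = 0 - 1 by ring,
        show z + 1 - y = z - y + 1 by ring, show z - 1 - y = z - y - 1 by ring, ← hr]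
      rw [hy1] at b
      linear_combination a + r * b + η * hpq
    rw [e]
    unfold vpot
    rw [hx1, hy1, ← hr]
    linarith
  · have b := gpot_harm hp hpq (sub_ne_zero.mpr hxy.ne')
    have a := gpot_zero (q := q) hp
    have g0 := gpot_nonneg h0.le (z - x)
    have g1 := gpot_pos_le h0.le h1 (show 0 < z - x by omega)
    have k := key (gpot (q/p) (z-x) + r) (by linarith)
    have hx1 : gpot (q/p) (z - z) = 1 := gpot_neg (by omega)
    have e : p * vpot (q/p) η x z (z+1) + q * vpot (q/p) η x z (z-1)
        = η + gpot (q/p) (z-x) + r * (2*q) := by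
      unfold vpot
      rw [show z + 1 - z = 0 + 1 by ring, show z - 1 - z = 0 - 1 by ring,
        show z + 1 - x = z - x + 1 by ring, show z - 1 - x = z - x - 1 by ring, ← hr]
      linear_combination r * a + b + η * hpq
    rw [e]
    unfold vpot
    rw [hx1, ← hr]
    have hα1 : 1 - α = (1 - 2*q)/(1+r) := by rw [hα]; field_simp; ring
    have : (1 - α) * (gpot (q/p) (z-x) + r) ≤ (1 - 2*q) * r := by
      rw [hα1, div_mul_eq_mul_div, div_le_iff₀ (by linarith)]
      have : gpot (q/p) (z-x) + r ≤ r * (1+r) := by nlinarith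
      nlinarith
    linarith

/-- partial sums of a deterministic sequence -/
def ps (x : ℕ → ℤ) (n : ℕ) : ℤ := ∑ i ∈ Finset.range n, x i

/-- visits to `{0, -D}` before time `n` -/
def cnt (x : ℕ → ℤ) (D : ℤ) (n : ℕ) : ℕ :=
  ((Finset.range n).filter (fun k => ps x k = 0 ∨ ps x k = -D)).card

lemma ps_congr {x y : ℕ → ℤ} {n : ℕ} (h : ∀ i < n, x i = y i) : ps x n = ps y n :=
  Finset.sum_congr rfl (fun i hi => h i (Finset.mem_range.mp hi))

lemma cnt_congr {x y : ℕ → ℤ} {D : ℤ} {n : ℕ} (h : ∀ i < n, x i = y i) : cnt x D n = cnt y D n := by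
  unfold cnt
  congr 1
  apply Finset.filter_congr
  intro k hk
  rw [ps_congr (fun i hi => h i (hi.trans (Finset.mem_range.mp hk)))]

lemma cnt_succ (x : ℕ → ℤ) (D : ℤ) (n : ℕ) :
    cnt x D (n+1) = cnt x D n + if ps x n = 0 ∨ ps x n = -D then 1 else 0 := by
  unfold cnt
  rw [Finset.range_add_one, Finset.filter_insert]
  split_ifs with h
  · rw [Finset.card_insert_of_notMem (by simp)]
  · rfl

lemma ps_succ (x : ℕ → ℤ) (n : ℕ) : ps x (n+1) = ps x n + x n := Finset.sum_range_succ _ _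

/-- extension by zero outside a finite set -/
noncomputable def ext0 (s : Finset ℕ) (t : s → ℤ) : ℕ → ℤ :=
  fun k => if h : k ∈ s then t ⟨k, h⟩ else 0

lemma dep_eq {X : ℕ → Ω → ℤ} {s : Finset ℕ} {φ : (ℕ → ℤ) → ℝ≥0∞}
    (hφ : ∀ x y : ℕ → ℤ, (∀ i ∈ s, x i = y i) → φ x = φ y) :
    (fun ω => φ (fun k => X k ω)) = (fun t : s → ℤ => φ (ext0 s t)) ∘ (fun ω (k : s) => X k ω) := by
  funext ω
  apply hφ
  intro i hi
  simp [ext0, hi]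

lemma dep_meas [MeasurableSpace Ω] {X : ℕ → Ω → ℤ} (hX : ∀ i, Measurable (X i))
    {s : Finset ℕ} {φ : (ℕ → ℤ) → ℝ≥0∞}
    (hφ : ∀ x y : ℕ → ℤ, (∀ i ∈ s, x i = y i) → φ x = φ y) :
    Measurable (fun ω => φ (fun k => X k ω)) := by
  rw [dep_eq hφ]
  exact (measurable_of_countable _).comp (measurable_pi_lambda _ (fun k => hX k))

lemma dep_indep [MeasurableSpace Ω] {P : Measure Ω} {X : ℕ → Ω → ℤ}
    (hX : ∀ i, Measurable (X i)) (hI : iIndepFun X P)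
    {s t : Finset ℕ} (hst : Disjoint s t) {φ ψ : (ℕ → ℤ) → ℝ≥0∞}
    (hφ : ∀ x y : ℕ → ℤ, (∀ i ∈ s, x i = y i) → φ x = φ y)
    (hψ : ∀ x y : ℕ → ℤ, (∀ i ∈ t, x i = y i) → ψ x = ψ y) :
    ∫⁻ ω, φ (fun k => X k ω) * ψ (fun k => X k ω) ∂P
      = (∫⁻ ω, φ (fun k => X k ω) ∂P) * ∫⁻ ω, ψ (fun k => X k ω) ∂P := by
  have h := hI.indepFun_finset s t hst hX
  have h2 := h.comp (φ := fun t : s → ℤ => φ (ext0 s t)) (ψ := fun u : t → ℤ => ψ (ext0 t u))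
    (measurable_of_countable _) (measurable_of_countable _)
  rw [← dep_eq hφ, ← dep_eq hψ] at h2
  exact lintegral_mul_eq_lintegral_mul_lintegral_of_indepFun (dep_meas hX hφ) (dep_meas hX hψ) h2

lemma psi_step {p q η γ : ℝ} (hq0 : 0 < q) (hq : q < 1/2) (hpq : p + q = 1)
    (hγ : (2*q + Real.sqrt (q/p)) / (1 + Real.sqrt (q/p)) < γ) (hγ0 : 0 < γ) (hγ1 : γ < 1)
    (hη0 : 0 < η) (hη : η * (1 - γ) =
      (γ - (2*q + Real.sqrt (q/p)) / (1 + Real.sqrt (q/p))) * Real.sqrt (q/p))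
    {D : ℤ} (hD : D ≠ 0) (x : ℕ → ℤ) (n : ℕ) :
    p * ((γ⁻¹) ^ cnt x D (n+1) * vpot (q/p) η (min 0 (-D)) (max 0 (-D)) (ps x n + 1))
      + q * ((γ⁻¹) ^ cnt x D (n+1) * vpot (q/p) η (min 0 (-D)) (max 0 (-D)) (ps x n - 1))
      ≤ (γ⁻¹) ^ cnt x D n * vpot (q/p) η (min 0 (-D)) (max 0 (-D)) (ps x n) := by
  have hp : 0 < p := by linarith
  rw [cnt_succ]
  set v := vpot (q/p) η (min 0 (-D)) (max 0 (-D))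
  have hpow : 0 < (γ⁻¹) ^ cnt x D n := by positivity
  split_ifs with h
  · have h' : ps x n = min 0 (-D) ∨ ps x n = max 0 (-D) := by omega
    have := vpot_on hq0 hq hpq hγ hγ1 hη (x := min 0 (-D)) (y := max 0 (-D)) (by omega) h'
    rw [pow_succ]
    calc _ = (γ⁻¹) ^ cnt x D n * (γ⁻¹ * (p * v (ps x n + 1) + q * v (ps x n - 1))) := by ring
      _ ≤ (γ⁻¹) ^ cnt x D n * (γ⁻¹ * (γ * v (ps x n))) := by gcongr
      _ = _ := by field_simp
  · have := vpot_off (η := η) hp hpq (x := min 0 (-D)) (y := max 0 (-D)) (z := ps x n)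
      (by omega) (by omega)
    apply le_of_eq
    change p * v _ + q * v _ = v _ at this
    rw [← this, add_zero]
    ring

lemma ae_pm [MeasurableSpace Ω] {P : Measure Ω} [IsProbabilityMeasure P] {X : ℕ → Ω → ℤ} {p q : ℝ}
    (hp : 0 ≤ p) (hq : 0 ≤ q) (hpq : p + q = 1) (hX : IsAsymmetricSRW P X p q) (n : ℕ) :
    ∀ᵐ ω ∂P, X n ω = 1 ∨ X n ω = -1 := by
  obtain ⟨hm, -, h1, h2⟩ := hX
  have m1 : MeasurableSet {ω | X n ω = 1} := hm n (measurableSet_singleton (1:ℤ))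
  have m2 : MeasurableSet {ω | X n ω = -1} := hm n (measurableSet_singleton (-1:ℤ))
  have : P ({ω | X n ω = 1} ∪ {ω | X n ω = -1}) = 1 := by
    rw [measure_union _ m2, h1, h2, ← ENNReal.ofReal_add hp hq, hpq, ENNReal.ofReal_one]
    rw [Set.disjoint_left]
    intro ω (h : X n ω = 1) (h' : X n ω = -1)
    omega
  have h3 := (prob_compl_eq_zero_iff (m1.union m2)).mpr this
  rw [ae_iff]
  convert h3 using 2
  ext ω
  simp

lemma lint_step [MeasurableSpace Ω] {P : Measure Ω} {X : ℕ → Ω → ℤ}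
    (hX : ∀ i, Measurable (X i)) (hI : iIndepFun X P) (n : ℕ) (a : ℤ) {r : ℝ≥0∞}
    (hr : P {ω | X n ω = a} = r)
    {φ : (ℕ → ℤ) → ℝ≥0∞}
    (hφ : ∀ x y : ℕ → ℤ, (∀ i ∈ Finset.range n, x i = y i) → φ x = φ y) :
    ∫⁻ ω, φ (fun k => X k ω) * (if X n ω = a then 1 else 0) ∂P
      = ∫⁻ ω, r * φ (fun k => X k ω) ∂P := by
  have := dep_indep hX hI (s := Finset.range n) (t := {n}) (by simp) hφ
    (ψ := fun x => if x n = a then 1 else 0) (by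
      intro x y h
      simp only [h n (by simp)])
  simp only at this
  rw [this, lintegral_const_mul _ (dep_meas hX hφ), mul_comm]
  congr 1
  rw [← hr]
  have m1 : MeasurableSet {ω | X n ω = a} := hX n (measurableSet_singleton a)
  rw [← lintegral_indicator_one m1]
  congr 1
  funext ω
  simp [Set.indicator_apply]

lemma mgf_v [MeasurableSpace Ω] {P : Measure Ω} [IsProbabilityMeasure P] {X : ℕ → Ω → ℤ}
    {p q η γ : ℝ} (hX : IsAsymmetricSRW P X p q) (hq0 : 0 < q) (hq : q < 1/2) (hpq : p + q = 1)
    (hγ : (2*q + Real.sqrt (q/p)) / (1 + Real.sqrt (q/p)) < γ) (hγ0 : 0 < γ) (hγ1 : γ < 1)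
    (hη0 : 0 < η) (hη : η * (1 - γ) =
      (γ - (2*q + Real.sqrt (q/p)) / (1 + Real.sqrt (q/p))) * Real.sqrt (q/p))
    {D : ℤ} (hD : D ≠ 0) (n : ℕ) :
    ∫⁻ ω, ENNReal.ofReal ((γ⁻¹) ^ cnt (fun k => X k ω) D n *
      vpot (q/p) η (min 0 (-D)) (max 0 (-D)) (ps (fun k => X k ω) n)) ∂P
      ≤ ENNReal.ofReal (η + 2) := by
  have hp : 0 < p := by linarith
  have h0 : 0 ≤ q/p := by positivity
  have h1 : q/p ≤ 1 := by rw [div_le_one hp]; linarith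
  have hvpos : ∀ z, 0 ≤ vpot (q/p) η (min 0 (-D)) (max 0 (-D)) z :=
    fun z => hη0.le.trans (vpot_ge h0 _ _ _)
  induction n with
  | zero =>
    calc _ ≤ ∫⁻ ω, ENNReal.ofReal (η + 2) ∂P := by
          apply lintegral_mono
          intro ω
          apply ENNReal.ofReal_le_ofReal
          simp only [cnt, Finset.range_zero, Finset.filter_empty, Finset.card_empty, pow_zero,
            one_mul]
          exact vpot_le h0 h1 _ _ _
      _ = _ := by simp
  | succ n ih =>
    refine le_trans ?_ ih
    have hsplit : ∀ a : ℤ, ∀ x y : ℕ → ℤ, (∀ i ∈ Finset.range n, x i = y i) →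
        ENNReal.ofReal ((γ⁻¹) ^ cnt x D (n+1) *
          vpot (q/p) η (min 0 (-D)) (max 0 (-D)) (ps x n + a)) =
        ENNReal.ofReal ((γ⁻¹) ^ cnt y D (n+1) *
          vpot (q/p) η (min 0 (-D)) (max 0 (-D)) (ps y n + a)) := by
      intro a x y h
      have h' : ∀ i < n, x i = y i := fun i hi => h i (Finset.mem_range.mpr hi)
      rw [cnt_succ, cnt_succ, cnt_congr h', ps_congr h']
    obtain ⟨hm, hI, hp1, hq1⟩ := id hX
    have e1 := lint_step hm hI n 1 (hp1 n) (hsplit 1)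
    have e2 := lint_step hm hI n (-1) (hq1 n) (hsplit (-1))
    have meas : ∀ a : ℤ, Measurable (fun ω => ENNReal.ofReal ((γ⁻¹) ^ cnt (fun k => X k ω) D (n+1) *
          vpot (q/p) η (min 0 (-D)) (max 0 (-D)) (ps (fun k => X k ω) n + a))) :=
      fun a => dep_meas hm (hsplit a)
    calc _ ≤ ∫⁻ ω, (ENNReal.ofReal ((γ⁻¹) ^ cnt (fun k => X k ω) D (n+1) *
          vpot (q/p) η (min 0 (-D)) (max 0 (-D)) (ps (fun k => X k ω) n + 1)) *
            (if X n ω = 1 then 1 else 0) +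
          ENNReal.ofReal ((γ⁻¹) ^ cnt (fun k => X k ω) D (n+1) *
          vpot (q/p) η (min 0 (-D)) (max 0 (-D)) (ps (fun k => X k ω) n + (-1))) *
            (if X n ω = -1 then 1 else 0)) ∂P := by
          apply lintegral_mono_ae
          filter_upwards [ae_pm hp.le hq0.le hpq hX n] with ω hω
          rw [ps_succ]
          rcases hω with h | h <;> simp [h]
      _ = ∫⁻ ω, (ENNReal.ofReal p * ENNReal.ofReal ((γ⁻¹) ^ cnt (fun k => X k ω) D (n+1) *
          vpot (q/p) η (min 0 (-D)) (max 0 (-D)) (ps (fun k => X k ω) n + 1)) +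
          ENNReal.ofReal q * ENNReal.ofReal ((γ⁻¹) ^ cnt (fun k => X k ω) D (n+1) *
          vpot (q/p) η (min 0 (-D)) (max 0 (-D)) (ps (fun k => X k ω) n + (-1)))) ∂P := by
          rw [lintegral_add_left, lintegral_add_left, e1, e2]
          · exact (meas 1).const_mul _
          · exact (meas 1).mul (Measurable.ite (hm n (measurableSet_singleton (1:ℤ)))
              measurable_const measurable_const)
      _ ≤ _ := by
          apply lintegral_mono
          intro ω
          have hg : 0 ≤ (γ⁻¹) ^ cnt (fun k => X k ω) D (n+1) := by positivity
          simp only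
          rw [← ENNReal.ofReal_mul hp.le, ← ENNReal.ofReal_mul hq0.le, ← ENNReal.ofReal_add
            (mul_nonneg hp.le (mul_nonneg hg (hvpos _))) (mul_nonneg hq0.le (mul_nonneg hg (hvpos _)))]
          apply ENNReal.ofReal_le_ofReal
          exact psi_step hq0 hq hpq hγ hγ0 hγ1 hη0 hη hD _ n

/-- Uniform exponential moment bound. -/
lemma mgf_bound {p q γ : ℝ} (hq0 : 0 < q) (hq : q < 1/2) (hpq : p + q = 1)
    (hγ : (2*q + Real.sqrt (q/p)) / (1 + Real.sqrt (q/p)) < γ) (hγ0 : 0 < γ) (hγ1 : γ < 1) :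
    ∃ K : ℝ, 0 < K ∧ ∀ {Ω : Type _} [MeasurableSpace Ω] (P : Measure Ω) [IsProbabilityMeasure P]
      (X : ℕ → Ω → ℤ), IsAsymmetricSRW P X p q → ∀ D : ℤ, D ≠ 0 → ∀ n : ℕ,
      ∫⁻ ω, ENNReal.ofReal ((γ⁻¹) ^ cnt (fun k => X k ω) D n) ∂P ≤ ENNReal.ofReal K := by
  have hp : 0 < p := by linarith
  have h0 : 0 < q/p := by positivity
  set η := (γ - (2*q + Real.sqrt (q/p)) / (1 + Real.sqrt (q/p))) * Real.sqrt (q/p) / (1 - γ)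
    with hηd
  have hη0 : 0 < η := by
    apply div_pos (mul_pos (by linarith) (Real.sqrt_pos.mpr h0)); linarith
  have hη : η * (1 - γ) =
      (γ - (2*q + Real.sqrt (q/p)) / (1 + Real.sqrt (q/p))) * Real.sqrt (q/p) := by
    rw [hηd]
    exact div_mul_cancel₀ _ (by linarith)
  refine ⟨η⁻¹ * (η + 2), by positivity, ?_⟩
  intro Ω _ P _ X hX D hD n
  have := mgf_v hX hq0 hq hpq hγ hγ0 hγ1 hη0 hη hD n
  rw [ENNReal.ofReal_mul (by positivity)]
  calc _ ≤ ∫⁻ ω, ENNReal.ofReal η⁻¹ * ENNReal.ofReal ((γ⁻¹) ^ cnt (fun k => X k ω) D n *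
      vpot (q/p) η (min 0 (-D)) (max 0 (-D)) (ps (fun k => X k ω) n)) ∂P := by
        apply lintegral_mono
        intro ω
        simp only
        rw [← ENNReal.ofReal_mul (by positivity)]
        apply ENNReal.ofReal_le_ofReal
        have hg : 0 ≤ (γ⁻¹) ^ cnt (fun k => X k ω) D n := by positivity
        have hv := vpot_ge (η := η) h0.le (min 0 (-D)) (max 0 (-D)) (ps (fun k => X k ω) n)
        calc (γ⁻¹) ^ cnt (fun k => X k ω) D n = η⁻¹ * ((γ⁻¹) ^ cnt (fun k => X k ω) D n * η) := by
              field_simp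
          _ ≤ _ := by gcongr
    _ = ENNReal.ofReal η⁻¹ * _ := lintegral_const_mul' _ _ ENNReal.ofReal_ne_top
    _ ≤ _ := by gcongr

/-- reversal of the first `i` indices -/
def rv (i k : ℕ) : ℕ := if k < i then i - 1 - k else k

lemma rv_inj (i : ℕ) : Function.Injective (rv i) := by
  intro a b h
  unfold rv at h
  split_ifs at h <;> omega

lemma ps_rv (x : ℕ → ℤ) (i m : ℕ) (hm : m ≤ i) :
    ps (fun k => x (rv i k)) m = ps x i - ps x (i - m) := by
  induction m with
  | zero => simp [ps]
  | succ m ih =>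
    rw [ps_succ, ih (by omega)]
    have e : i - m = (i - (m+1)) + 1 := by omega
    rw [e, ps_succ]
    have : rv i m = i - (m+1) := by unfold rv; rw [if_pos (by omega)]; omega
    rw [this]; ring

lemma ps_shift (x : ℕ → ℤ) (j m : ℕ) :
    ps (fun k => x (j + k)) m = ps x (j + m) - ps x j := by
  induction m with
  | zero => simp [ps]
  | succ m ih => rw [ps_succ, ih, ← add_assoc, ps_succ]; ring

lemma pair_det (x : ℕ → ℤ) (i j M : ℕ) (D : ℤ) (hD : D ≠ 0) (hDe : ps x j - ps x i = D)
    (hbet : ∀ l, i < l → l < j → ps x l ≠ ps x i ∧ ps x l ≠ ps x j) :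
    ((Finset.Icc 1 M).filter (fun k => ps x k = ps x i)).card
      + ((Finset.Icc 1 M).filter (fun k => ps x k = ps x j)).card
      ≤ cnt (fun k => x (rv i k)) D i + cnt (fun k => x (j + k)) D (M+1) := by
  rw [← Finset.card_union_of_disjoint]
  · unfold cnt
    refine le_trans ?_ (add_le_add (Finset.card_image_le (f := fun k => i - k))
      (Finset.card_image_le (f := fun k => j + k)))
    refine le_trans (Finset.card_le_card ?_) (Finset.card_union_le _ _)
    intro l hl
    simp only [Finset.mem_union, Finset.mem_filter, Finset.mem_Icc, Finset.mem_image,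
      Finset.mem_range] at hl ⊢
    rcases Nat.lt_or_ge i l with h | h
    · rcases Nat.lt_or_ge l j with h' | h'
      · have := hbet l h h'
        tauto
      · right
        refine ⟨l - j, ⟨by omega, ?_⟩, by omega⟩
        rw [ps_shift, show j + (l - j) = l by omega]
        omega
    · left
      refine ⟨i - l, ⟨by omega, ?_⟩, by omega⟩
      rw [ps_rv _ _ _ (by omega), show i - (i - l) = l by omega]
      omega
  · rw [Finset.disjoint_left]
    intro l hl hl'
    simp only [Finset.mem_filter] at hl hl'
    omega

lemma srw_precomp [MeasurableSpace Ω] {P : Measure Ω} {X : ℕ → Ω → ℤ} {p q : ℝ}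
    (hX : IsAsymmetricSRW P X p q) {g : ℕ → ℕ} (hg : Function.Injective g) :
    IsAsymmetricSRW P (fun k => X (g k)) p q :=
  ⟨fun i => hX.1 _, hX.2.1.precomp hg, fun i => hX.2.2.1 _, fun i => hX.2.2.2 _⟩

lemma pair_prob_D [MeasurableSpace Ω] {P : Measure Ω} [IsProbabilityMeasure P] {X : ℕ → Ω → ℤ}
    {p q γ K : ℝ} (hX : IsAsymmetricSRW P X p q) (hγ0 : 0 < γ)
    (hK : ∀ (X : ℕ → Ω → ℤ), IsAsymmetricSRW P X p q → ∀ D : ℤ, D ≠ 0 → ∀ n : ℕ,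
      ∫⁻ ω, ENNReal.ofReal ((γ⁻¹) ^ cnt (fun k => X k ω) D n) ∂P ≤ ENNReal.ofReal K)
    (i j M : ℕ) (hij : i < j) (D : ℤ) (hD : D ≠ 0) (B : ℝ) (hB : 0 < B) :
    P {ω | ps (fun k => X k ω) j - ps (fun k => X k ω) i = D ∧
        B ≤ (γ⁻¹) ^ (cnt (fun k => X (rv i k) ω) D i + cnt (fun k => X (j + k) ω) D (M+1))}
      ≤ ENNReal.ofReal B⁻¹ * (ENNReal.ofReal K * ENNReal.ofReal K) *
        P {ω | ps (fun k => X k ω) j - ps (fun k => X k ω) i = D} := by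
  obtain ⟨hm, hI, -, -⟩ := id hX
  let φ : (ℕ → ℤ) → ℝ≥0∞ := fun x => ENNReal.ofReal ((γ⁻¹) ^ cnt (fun k => x (rv i k)) D i)
  let ψ : (ℕ → ℤ) → ℝ≥0∞ := fun x => ENNReal.ofReal ((γ⁻¹) ^ cnt (fun k => x (j + k)) D (M+1))
  let χ : (ℕ → ℤ) → ℝ≥0∞ := fun x => if ps x j - ps x i = D then 1 else 0
  have hφ : ∀ x y : ℕ → ℤ, (∀ k ∈ Finset.range i, x k = y k) → φ x = φ y := by
    intro x y h
    simp only [φ]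
    rw [cnt_congr]
    intro k hk
    apply h
    unfold rv
    rw [if_pos hk, Finset.mem_range]; omega
  have hψ : ∀ x y : ℕ → ℤ, (∀ k ∈ Finset.Ico j (j+M+1), x k = y k) → ψ x = ψ y := by
    intro x y h
    simp only [ψ]
    rw [cnt_congr]
    intro k hk
    apply h
    rw [Finset.mem_Ico]; omega
  have hχ : ∀ x y : ℕ → ℤ, (∀ k ∈ Finset.Ico i j, x k = y k) → χ x = χ y := by
    intro x y h
    have e : ∀ x : ℕ → ℤ, ps x j - ps x i = ps (fun k => x (i + k)) (j - i) := by
      intro x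
      rw [ps_shift, show i + (j - i) = j by omega]
    simp only [χ, e]
    rw [ps_congr]
    intro k hk
    apply h
    rw [Finset.mem_Ico]; omega
  have hχψ : ∀ x y : ℕ → ℤ, (∀ k ∈ Finset.Ico i (j+M+1), x k = y k) →
      (χ x * ψ x) = (χ y * ψ y) := by
    intro x y h
    rw [hχ x y, hψ x y]
    · intro k hk
      apply h; rw [Finset.mem_Ico] at hk ⊢; omega
    · intro k hk
      apply h; rw [Finset.mem_Ico] at hk ⊢; omega
  have e1 := dep_indep hm hI (s := Finset.range i) (t := Finset.Ico i (j+M+1)) (by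
    rw [Finset.disjoint_left]; intro k hk hk'
    rw [Finset.mem_range] at hk; rw [Finset.mem_Ico] at hk'; omega) hφ hχψ
  have e2 := dep_indep hm hI (s := Finset.Ico i j) (t := Finset.Ico j (j+M+1)) (by
    rw [Finset.disjoint_left]; intro k hk hk'
    rw [Finset.mem_Ico] at hk hk'; omega) hχ hψ
  have b1 : ∫⁻ ω, φ (fun k => X k ω) ∂P ≤ ENNReal.ofReal K :=
    hK _ (srw_precomp hX (rv_inj i)) D hD i
  have b2 : ∫⁻ ω, ψ (fun k => X k ω) ∂P ≤ ENNReal.ofReal K :=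
    hK _ (srw_precomp hX (add_right_injective j)) D hD (M+1)
  have b3 : ∫⁻ ω, χ (fun k => X k ω) ∂P
      = P {ω | ps (fun k => X k ω) j - ps (fun k => X k ω) i = D} := by
    have mS : ∀ n, Measurable (fun ω => ps (fun k => X k ω) n) := fun n =>
      Finset.measurable_sum _ (fun k _ => hm k)
    have m1 : MeasurableSet {ω | ps (fun k => X k ω) j - ps (fun k => X k ω) i = D} :=
      ((mS j).sub (mS i)) (measurableSet_singleton D)
    rw [← lintegral_indicator_one m1]
    congr 1
    funext ω
    simp [χ, Set.indicator_apply]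
  have meas : Measurable (fun ω => φ (fun k => X k ω) * (χ (fun k => X k ω) * ψ (fun k => X k ω))) :=
    (dep_meas hm hφ).mul (dep_meas hm hχψ)
  have markov := mul_meas_ge_le_lintegral (μ := P) meas (ENNReal.ofReal B)
  rw [e1, e2, b3] at markov
  have hB' : ENNReal.ofReal B⁻¹ * ENNReal.ofReal B = 1 := by
    rw [← ENNReal.ofReal_mul (by positivity), inv_mul_cancel₀ hB.ne', ENNReal.ofReal_one]
  calc _ ≤ P {ω | ENNReal.ofReal B ≤
        φ (fun k => X k ω) * (χ (fun k => X k ω) * ψ (fun k => X k ω))} := by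
        apply measure_mono
        rintro ω ⟨h1, h2⟩
        simp only [Set.mem_ofPred_eq, φ, χ, ψ]
        rw [if_pos h1, one_mul, ← ENNReal.ofReal_mul (by positivity), ← pow_add]
        exact ENNReal.ofReal_le_ofReal h2
    _ = ENNReal.ofReal B⁻¹ * (ENNReal.ofReal B * P {ω | ENNReal.ofReal B ≤
        φ (fun k => X k ω) * (χ (fun k => X k ω) * ψ (fun k => X k ω))}) := by
        rw [← mul_assoc, hB', one_mul]
    _ ≤ ENNReal.ofReal B⁻¹ * (ENNReal.ofReal K *
        (P {ω | ps (fun k => X k ω) j - ps (fun k => X k ω) i = D} * ENNReal.ofReal K)) := by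
        refine mul_le_mul_right (markov.trans ?_) _
        exact mul_le_mul' b1 (mul_le_mul' le_rfl b2)
    _ = _ := by ring

lemma pair_prob [MeasurableSpace Ω] {P : Measure Ω} [IsProbabilityMeasure P] {X : ℕ → Ω → ℤ}
    {p q γ K : ℝ} (hX : IsAsymmetricSRW P X p q) (hγ0 : 0 < γ) (hγ1 : γ < 1)
    (hK : ∀ (X : ℕ → Ω → ℤ), IsAsymmetricSRW P X p q → ∀ D : ℤ, D ≠ 0 → ∀ n : ℕ,
      ∫⁻ ω, ENNReal.ofReal ((γ⁻¹) ^ cnt (fun k => X k ω) D n) ∂P ≤ ENNReal.ofReal K)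
    (i j M : ℕ) (hij : i < j) (m : ℝ) :
    P {ω | m ≤ min (localTime X (S X i ω) M ω : ℝ) (localTime X (S X j ω) M ω)
          ∧ (∀ l : ℕ, i < l → l < j → S X l ω ≠ S X i ω ∧ S X l ω ≠ S X j ω)
          ∧ S X i ω ≠ S X j ω}
      ≤ ENNReal.ofReal (γ ^ (2 * m)) * (ENNReal.ofReal K * ENNReal.ofReal K) := by
  obtain ⟨hm, hI, -, -⟩ := id hX
  set B : ℝ := (γ⁻¹) ^ (2 * m) with hBd
  have hB : 0 < B := Real.rpow_pos_of_pos (by positivity) _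
  have hBi : B⁻¹ = γ ^ (2*m) := by rw [hBd, Real.inv_rpow hγ0.le, inv_inv]
  have hg1 : 1 ≤ γ⁻¹ := (one_le_inv₀ hγ0).mpr hγ1.le
  have mS : ∀ n, Measurable (fun ω => ps (fun k => X k ω) n) := fun n =>
    Finset.measurable_sum _ (fun k _ => hm k)
  have md : Measurable (fun ω => ps (fun k => X k ω) j - ps (fun k => X k ω) i) := (mS j).sub (mS i)
  have htot : ∑' D : ℤ, P {ω | ps (fun k => X k ω) j - ps (fun k => X k ω) i = D} = 1 := by
    rw [← measure_univ (μ := P), ← measure_iUnion]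
    · congr 1
      ext ω
      simp
    · intro a b hab
      rw [Function.onFun, Set.disjoint_left]
      intro ω (h : _ = a) (h' : _ = b)
      exact hab (h.symm.trans h')
    · intro D
      exact md (measurableSet_singleton D)
  rw [← hBi]
  calc _ ≤ P (⋃ D : ℤ, {ω | D ≠ 0 ∧ ps (fun k => X k ω) j - ps (fun k => X k ω) i = D ∧
        B ≤ (γ⁻¹) ^ (cnt (fun k => X (rv i k) ω) D i + cnt (fun k => X (j + k) ω) D (M+1))}) := by
        apply measure_mono
        rintro ω ⟨h1, h2, h3⟩
        rw [Set.mem_iUnion]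
        have hD : ps (fun k => X k ω) j - ps (fun k => X k ω) i ≠ 0 := sub_ne_zero.mpr h3.symm
        refine ⟨ps (fun k => X k ω) j - ps (fun k => X k ω) i, hD, rfl, ?_⟩
        have hd := pair_det (fun k => X k ω) i j M _ hD rfl h2
        have h1a : m ≤ (localTime X (S X i ω) M ω : ℝ) := h1.trans (min_le_left _ _)
        have h1b : m ≤ (localTime X (S X j ω) M ω : ℝ) := h1.trans (min_le_right _ _)
        have hd' : localTime X (S X i ω) M ω + localTime X (S X j ω) M ω ≤
          cnt (fun k => X (rv i k) ω) (ps (fun k => X k ω) j - ps (fun k => X k ω) i) i +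
          cnt (fun k => X (j + k) ω) (ps (fun k => X k ω) j - ps (fun k => X k ω) i) (M+1) := hd
        have hd2 : ((localTime X (S X i ω) M ω + localTime X (S X j ω) M ω : ℕ) : ℝ) ≤
          ((cnt (fun k => X (rv i k) ω) (ps (fun k => X k ω) j - ps (fun k => X k ω) i) i +
          cnt (fun k => X (j + k) ω) (ps (fun k => X k ω) j - ps (fun k => X k ω) i) (M+1) : ℕ) : ℝ) :=
          Nat.cast_le.mpr hd'
        rw [hBd, ← Real.rpow_natCast]
        apply Real.rpow_le_rpow_of_exponent_le hg1
        refine le_trans ?_ hd2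
        rw [Nat.cast_add]
        linarith
    _ ≤ ∑' D : ℤ, P {ω | D ≠ 0 ∧ ps (fun k => X k ω) j - ps (fun k => X k ω) i = D ∧
        B ≤ (γ⁻¹) ^ (cnt (fun k => X (rv i k) ω) D i + cnt (fun k => X (j + k) ω) D (M+1))} :=
        measure_iUnion_le _
    _ ≤ ∑' D : ℤ, ENNReal.ofReal B⁻¹ * (ENNReal.ofReal K * ENNReal.ofReal K) *
        P {ω | ps (fun k => X k ω) j - ps (fun k => X k ω) i = D} := by
        apply ENNReal.tsum_le_tsum
        intro D
        by_cases hD : D = 0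
        · simp [hD]
        · refine le_trans (measure_mono ?_) (pair_prob_D hX hγ0 hK i j M hij D hD B hB)
          rintro ω ⟨-, h⟩
          exact h
    _ = _ := by rw [ENNReal.tsum_mul_left, htot, mul_one]

lemma fcount_prob [MeasurableSpace Ω] {P : Measure Ω} [IsProbabilityMeasure P] {X : ℕ → Ω → ℤ}
    {p q γ K : ℝ} (hX : IsAsymmetricSRW P X p q) (hγ0 : 0 < γ) (hγ1 : γ < 1) (hK0 : 0 < K)
    (hK : ∀ (X : ℕ → Ω → ℤ), IsAsymmetricSRW P X p q → ∀ D : ℤ, D ≠ 0 → ∀ n : ℕ,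
      ∫⁻ ω, ENNReal.ofReal ((γ⁻¹) ^ cnt (fun k => X k ω) D n) ∂P ≤ ENNReal.ofReal K)
    (ε a b : ℝ) (ha : 1 ≤ a) (hl : 0 ≤ -1 / Real.log (2*q)) :
    P {ω | 0 < Fcount q X ε a b ω} ≤ ENNReal.ofReal
      (a * (2 * (-1 / Real.log (2*q)) * Real.log a) *
        (γ ^ (2 * ((1 - ε) * (-1 / Real.log (2*q)) * Real.log b)) * (K * K))) := by
  set lam := -1 / Real.log (2*q) with hlam
  set m := (1 - ε) * lam * Real.log b with hmd
  set M := ⌊a⌋₊ with hM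
  have hla : 0 ≤ Real.log a := Real.log_nonneg ha
  have hL : 0 ≤ 2 * lam * Real.log a := by positivity
  set E : ℕ → ℕ → Set Ω := fun i j =>
    {ω | m ≤ min (localTime X (S X i ω) M ω : ℝ) (localTime X (S X j ω) M ω)
          ∧ (∀ l : ℕ, i < l → l < j → S X l ω ≠ S X i ω ∧ S X l ω ≠ S X j ω)
          ∧ S X i ω ≠ S X j ω} with hE
  set J : ℕ → Finset ℕ := fun i =>
    Finset.Icc (i + 1) (min ⌊(i : ℝ) + 2 * lam * Real.log a⌋₊ M) with hJ
  set R : ℝ := γ ^ (2 * m) * (K * K) with hR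
  have hR0 : 0 ≤ R := by positivity
  have hEp : ∀ i, ∀ j ∈ J i, P (E i j) ≤ ENNReal.ofReal R := by
    intro i j hj
    rw [hJ, Finset.mem_Icc] at hj
    have := pair_prob hX hγ0 hγ1 hK i j M (by omega) m
    rw [hR, ENNReal.ofReal_mul (by positivity), ENNReal.ofReal_mul hK0.le]
    exact this
  have hcard : ∀ i, ((J i).card : ℝ) ≤ 2 * lam * Real.log a := by
    intro i
    have h1 : (J i).card ≤ ⌊(i : ℝ) + 2 * lam * Real.log a⌋₊ - i := by
      rw [hJ, Nat.card_Icc]; omega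
    have h2 : ⌊(i : ℝ) + 2 * lam * Real.log a⌋₊ - i = ⌊2 * lam * Real.log a⌋₊ := by
      rw [add_comm, Nat.floor_add_natCast hL]; omega
    rw [h2] at h1
    exact (Nat.cast_le.mpr h1).trans (Nat.floor_le hL)
  have hsub : {ω | 0 < Fcount q X ε a b ω} ⊆ ⋃ i ∈ Finset.Icc 1 M, ⋃ j ∈ J i, E i j := by
    intro ω hω
    rw [Set.mem_ofPred_eq, Fcount] at hω
    by_contra hcon
    simp only [Set.mem_iUnion, not_exists] at hcon
    have : (0:ℕ) < 0 := by
      refine lt_of_lt_of_eq hω ?_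
      apply Finset.sum_eq_zero
      intro i hi
      apply Finset.sum_eq_zero
      intro j hj
      rw [if_neg]
      exact hcon i hi j hj
    omega
  calc P {ω | 0 < Fcount q X ε a b ω} ≤ P (⋃ i ∈ Finset.Icc 1 M, ⋃ j ∈ J i, E i j) :=
        measure_mono hsub
    _ ≤ ∑ i ∈ Finset.Icc 1 M, P (⋃ j ∈ J i, E i j) := measure_biUnion_finset_le _ _
    _ ≤ ∑ i ∈ Finset.Icc 1 M, ENNReal.ofReal (2 * lam * Real.log a * R) := by
        apply Finset.sum_le_sum
        intro i _
        calc P (⋃ j ∈ J i, E i j) ≤ ∑ j ∈ J i, P (E i j) := measure_biUnion_finset_le _ _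
          _ ≤ ∑ j ∈ J i, ENNReal.ofReal R := Finset.sum_le_sum (hEp i)
          _ = ENNReal.ofReal ((J i).card * R) := by
              rw [Finset.sum_const, nsmul_eq_mul, ENNReal.ofReal_mul (Nat.cast_nonneg _),
                ENNReal.ofReal_natCast]
          _ ≤ _ := by
              apply ENNReal.ofReal_le_ofReal
              exact mul_le_mul_of_nonneg_right (hcard i) hR0
    _ = ENNReal.ofReal (M * (2 * lam * Real.log a * R)) := by
        rw [Finset.sum_const, nsmul_eq_mul, ENNReal.ofReal_mul (Nat.cast_nonneg _),
                ENNReal.ofReal_natCast, Nat.card_Icc, Nat.add_sub_cancel]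
    _ ≤ _ := by
        apply ENNReal.ofReal_le_ofReal
        rw [mul_assoc a]
        have hMa : (M:ℝ) ≤ a := Nat.floor_le (by linarith)
        exact mul_le_mul_of_nonneg_right hMa (mul_nonneg hL hR0)

end helpers

/-- For `ε ∈ (0,1)` with `(1+δ)(1-ε)² > 1+δ/2` and `ρ > 0` with `ρδ/2 > 1+δ`,
there is `C > 0` such that for all large `n`, `P(F_{(n+1)^ρ, n^ρ} > 0) ≤ C n^{-(1+δ)}`. -/
theorem prob_pair_count_positive
    [MeasurableSpace Ω] (P : Measure Ω) [IsProbabilityMeasure P]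
    (X : ℕ → Ω → ℤ) (p q : ℝ) (hq0 : 0 < q) (hq : q < 1/2) (hpq : p + q = 1)
    (hX : IsAsymmetricSRW P X p q)
    (δ : ℝ)
    (hδ : δ = 2 * Real.log ((2*q + Real.sqrt (q/p)) / (1 + Real.sqrt (q/p))) / Real.log (2*q) - 1)
    (ε : ℝ) (hε : ε ∈ Set.Ioo (0:ℝ) 1) (hε2 : (1 + δ) * (1 - ε)^2 > 1 + δ/2)
    (ρ : ℝ) (hρ0 : 0 < ρ) (hρ : ρ * δ / 2 > 1 + δ) :
    ∃ C : ℝ, 0 < C ∧ ∃ N : ℕ, ∀ n : ℕ, N ≤ n →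
      P {ω | 0 < Fcount q X ε (((n : ℝ) + 1) ^ ρ) ((n : ℝ) ^ ρ) ω}
        ≤ ENNReal.ofReal (C * (n : ℝ) ^ (-(1 + δ))) := by
  have hp : 0 < p := by linarith
  have h0 : 0 < q/p := by positivity
  set r := Real.sqrt (q/p) with hr
  have hr0 : 0 < r := Real.sqrt_pos.mpr h0
  set α := (2*q + r) / (1 + r) with hα
  have hα0 : 0 < α := by positivity
  have hα1 : α < 1 := by rw [hα, div_lt_one (by positivity)]; linarith
  have hlq : Real.log (2*q) < 0 := Real.log_neg (by linarith) (by linarith)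
  have hla : Real.log α < 0 := Real.log_neg hα0 hα1
  have hδ1 : 1 + δ = 2 * Real.log α / Real.log (2*q) := by rw [hδ]; ring
  have hδpos : 0 < 1 + δ := by
    rw [hδ1]; exact div_pos_of_neg_of_neg (by linarith) hlq
  obtain ⟨hε0, hε1⟩ := hε
  set γ := α ^ (1 - ε) with hγd
  have hγ0 : 0 < γ := Real.rpow_pos_of_pos hα0 _
  have hγ1 : γ < 1 := Real.rpow_lt_one hα0.le hα1 (by linarith)
  have hγ : α < γ := by
    calc α = α ^ (1:ℝ) := (Real.rpow_one α).symm
      _ < α ^ (1 - ε) := Real.rpow_lt_rpow_of_exponent_gt hα0 hα1 (by linarith)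
  obtain ⟨K, hK0, hK⟩ := mgf_bound hq0 hq hpq hγ hγ0 hγ1
  set lam := -1 / Real.log (2*q) with hlam
  have hlam0 : 0 < lam := div_pos_of_neg_of_neg (by norm_num) hlq
  set κ := (1 + δ) * (1 - ε)^2 with hκ
  set τ := κ * ρ - ρ - (1 + δ) with hτ
  have hτ0 : 0 < τ := by
    have : (1 + δ/2) * ρ < κ * ρ := mul_lt_mul_of_pos_right hε2 hρ0
    rw [hτ]; nlinarith
  refine ⟨2 ^ (ρ + τ) * (2 * lam * (ρ / τ)) * (K * K), by positivity, 1, ?_⟩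
  intro n hn
  have hn1 : (1:ℝ) ≤ n := by exact_mod_cast hn
  have hn0 : (0:ℝ) < n := by linarith
  have ha : (1:ℝ) ≤ ((n:ℝ)+1) ^ ρ := Real.one_le_rpow (by linarith) hρ0.le
  refine (fcount_prob hX hγ0 hγ1 hK0 (fun X hX => hK P X hX) ε _ ((n:ℝ)^ρ) ha hlam0.le).trans ?_
  apply ENNReal.ofReal_le_ofReal
  rw [← hlam]
  -- the power of gamma
  have eγ : γ ^ (2 * ((1 - ε) * lam * Real.log ((n:ℝ)^ρ))) = (n:ℝ) ^ (-(κ * ρ)) := by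
    rw [Real.log_rpow hn0, hγd, ← Real.rpow_mul hα0.le, Real.rpow_def_of_pos hα0,
      Real.rpow_def_of_pos hn0, hκ, hδ1, hlam]
    congr 1
    field_simp
  have elog : Real.log (((n:ℝ)+1)^ρ) ≤ ρ / τ * ((n:ℝ)+1)^τ := by
    rw [Real.log_rpow (by linarith)]
    have := Real.log_le_rpow_div (x := (n:ℝ)+1) (by linarith) hτ0
    calc ρ * Real.log ((n:ℝ)+1) ≤ ρ * (((n:ℝ)+1)^τ / τ) := by gcongr
      _ = _ := by ring
  rw [eγ]
  calc _ ≤ ((n:ℝ)+1)^ρ * (2 * lam * (ρ / τ * ((n:ℝ)+1)^τ)) * ((n:ℝ) ^ (-(κ * ρ)) * (K * K)) := by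
        gcongr
    _ = ((n:ℝ)+1)^(ρ + τ) * (2 * lam * (ρ / τ)) * (K * K) * (n:ℝ) ^ (-(κ * ρ)) := by
        rw [Real.rpow_add (by linarith)]; ring
    _ ≤ (2 * (n:ℝ))^(ρ + τ) * (2 * lam * (ρ / τ)) * (K * K) * (n:ℝ) ^ (-(κ * ρ)) := by
        gcongr
        linarith
    _ = 2 ^ (ρ + τ) * (2 * lam * (ρ / τ)) * (K * K) * ((n:ℝ)^(ρ+τ) * (n:ℝ) ^ (-(κ * ρ))) := by
        rw [Real.mul_rpow (by norm_num) hn0.le]; ring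
    _ = _ := by
        rw [← Real.rpow_add hn0]
        congr 2
        rw [hτ]; ring
end

section
/- There exists a constant C > 0 such that for every positive integer m, Σ_{n ≥ m/2} P(S_n < 0) ≤ C (4pq)^{m/4} / √m. -/
open MeasureTheory ProbabilityTheory Filter Set
open scoped ENNReal NNReal

variable {Ω : Type*}

lemma aux_central (m : ℕ) : (2 * m + 1) * (Nat.centralBinom m) ^ 2 ≤ 16 ^ m := by
  induction m with
  | zero => simp
  | succ m ih =>
    have h := Nat.succ_mul_centralBinom_succ m
    have h2 : (m + 1) ^ 2 * ((2 * (m + 1) + 1) * (Nat.centralBinom (m + 1)) ^ 2)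
        = (4 * (2 * m + 3) * (2 * m + 1)) * ((2 * m + 1) * (Nat.centralBinom m) ^ 2) := by
      calc _ = (2 * m + 3) * ((m + 1) * Nat.centralBinom (m + 1)) ^ 2 := by ring
        _ = _ := by rw [h]; ring
    have h3 : (4 * (2 * m + 3) * (2 * m + 1)) * ((2 * m + 1) * (Nat.centralBinom m) ^ 2)
        ≤ (m + 1) ^ 2 * 16 ^ (m + 1) := by
      calc _ ≤ (4 * (2 * m + 3) * (2 * m + 1)) * 16 ^ m := by gcongr
        _ ≤ (16 * (m + 1) ^ 2) * 16 ^ m := by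
          apply Nat.mul_le_mul_right
          nlinarith
        _ = _ := by ring
    rw [← h2] at h3
    exact Nat.le_of_mul_le_mul_left h3 (by positivity)

lemma aux_middle (n : ℕ) : n * (n.choose (n / 2)) ^ 2 ≤ 4 ^ n := by
  rcases Nat.even_or_odd' n with ⟨m, rfl | rfl⟩
  · have h := aux_central m
    have e : 2 * m / 2 = m := by omega
    rw [e, pow_mul]
    rw [Nat.centralBinom] at h
    norm_num
    nlinarith
  · have h := aux_central m
    have e : (2 * m + 1) / 2 = m := by omega
    rw [e]
    have h2 : (2 * m + 1).choose m ≤ 2 * Nat.centralBinom m := by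
      rcases m with _ | m
      · simp
      · rw [Nat.choose_succ_succ]
        have h1 := Nat.choose_le_centralBinom m (m + 1)
        have h2 := Nat.choose_le_centralBinom (m + 1) (m + 1)
        simp only [Nat.succ_eq_add_one] at *
        omega
    calc _ ≤ (2 * m + 1) * (2 * Nat.centralBinom m) ^ 2 := by gcongr
      _ = 4 * ((2 * m + 1) * (Nat.centralBinom m) ^ 2) := by ring
      _ ≤ 4 * 16 ^ m := by gcongr
      _ = _ := by rw [pow_succ, pow_mul]; norm_num; ring

lemma aux_choose (n k : ℕ) (hn : 1 ≤ n) : (n.choose k : ℝ) ≤ 2 ^ n / Real.sqrt n := by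
  have hn' : (0 : ℝ) < n := by exact_mod_cast hn
  have h0 : (n.choose k : ℝ) ≤ n.choose (n / 2) := by exact_mod_cast Nat.choose_le_middle k n
  refine h0.trans ?_
  rw [le_div_iff₀ (Real.sqrt_pos.2 hn')]
  refine (sq_le_sq₀ (by positivity) (by positivity)).1 ?_
  rw [mul_pow, Real.sq_sqrt hn'.le, ← pow_mul, mul_comm n 2, pow_mul]
  have := aux_middle n
  have h : ((n * (n.choose (n / 2)) ^ 2 : ℕ) : ℝ) ≤ ((4 ^ n : ℕ) : ℝ) := by exact_mod_cast this
  push_cast at h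
  norm_num
  linarith

lemma aux_sum (p q : ℝ) (hq0 : 0 < q) (hlt : q < p) (n : ℕ) (hn : 1 ≤ n) :
    ∑ k ∈ (Finset.range (n + 1)).filter (fun k => 2 * k < n), (n.choose k : ℝ) * (p ^ k * q ^ (n - k))
      ≤ (Real.sqrt (4 * p * q)) ^ n / Real.sqrt n * (1 - Real.sqrt q / Real.sqrt p)⁻¹ := by
  have hp0 : 0 < p := hq0.trans hlt
  have ha : 0 < Real.sqrt p := Real.sqrt_pos.2 hp0
  have hb : 0 < Real.sqrt q := Real.sqrt_pos.2 hq0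
  have hab : Real.sqrt q < Real.sqrt p := Real.sqrt_lt_sqrt hq0.le hlt
  have e4 : Real.sqrt (4 * p * q) = 2 * (Real.sqrt p * Real.sqrt q) := by
    rw [show 4 * p * q = 2 ^ 2 * (p * q) by ring, Real.sqrt_mul (by positivity),
      Real.sqrt_sq (by norm_num), Real.sqrt_mul hp0.le]
  rw [e4]
  have hp2 := Real.sq_sqrt hp0.le
  have hq2 := Real.sq_sqrt hq0.le
  generalize Real.sqrt p = a at *
  generalize Real.sqrt q = b at *
  subst hp2 hq2
  have hr0 : 0 ≤ b / a := by positivity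
  have hr1 : b / a < 1 := (div_lt_one ha).2 hab
  calc _ ≤ ∑ k ∈ (Finset.range (n + 1)).filter (fun k => 2 * k < n),
        2 ^ n / Real.sqrt n * (a * b) ^ n * (b / a) ^ (n - 2 * k) := by
        apply Finset.sum_le_sum
        intro k hk
        simp only [Finset.mem_filter] at hk
        obtain ⟨j, hj⟩ : ∃ j, n = 2 * k + j := ⟨n - 2 * k, by omega⟩
        have e : (a ^ 2) ^ k * (b ^ 2) ^ (n - k) = (a * b) ^ n * (b / a) ^ (n - 2 * k) := by
          have e1 : n - k = k + j := by omega
          have e2 : n - 2 * k = j := by omega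
          rw [e1, e2, hj, div_pow]
          field_simp
          ring
        rw [e, mul_assoc (2 ^ n / Real.sqrt n)]
        gcongr
        exact aux_choose n k hn
    _ = 2 ^ n / Real.sqrt n * (a * b) ^ n * ∑ k ∈ (Finset.range (n + 1)).filter (fun k => 2 * k < n),
        (b / a) ^ (n - 2 * k) := by rw [Finset.mul_sum]
    _ ≤ 2 ^ n / Real.sqrt n * (a * b) ^ n * (1 - b / a)⁻¹ := by
        gcongr
        rw [← Finset.sum_image (f := fun j => (b / a) ^ j) (g := fun k => n - 2 * k)]
        · rw [← tsum_geometric_of_lt_one hr0 hr1]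
          exact (summable_geometric_of_lt_one hr0 hr1).sum_le_tsum _ (fun i _ => by positivity)
        · intro x hx y hy hxy
          simp at hx hy hxy
          omega
    _ = _ := by rw [mul_pow 2]; ring

lemma aux_prob [MeasurableSpace Ω] (P : Measure Ω) [IsProbabilityMeasure P]
    (X : ℕ → Ω → ℤ) (p q : ℝ) (hq0 : 0 < q) (hp0 : 0 < p) (hpq : p + q = 1)
    (hX : IsAsymmetricSRW P X p q) (n : ℕ) :
    P {ω | S X n ω < 0} ≤ ENNReal.ofReal
      (∑ k ∈ (Finset.range (n + 1)).filter (fun k => 2 * k < n),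
        (n.choose k : ℝ) * (p ^ k * q ^ (n - k))) := by
  obtain ⟨hm, hind, h1, h2⟩ := hX
  have hae : ∀ᵐ ω ∂P, ∀ i, X i ω = 1 ∨ X i ω = -1 := by
    rw [ae_all_iff]
    intro i
    have hm1 : MeasurableSet {ω | X i ω = 1} := hm i (measurableSet_singleton 1)
    have hm2 : MeasurableSet {ω | X i ω = -1} := hm i (measurableSet_singleton (-1))
    have hu : P ({ω | X i ω = 1} ∪ {ω | X i ω = -1}) = 1 := by
      rw [measure_union _ hm2, h1, h2, ← ENNReal.ofReal_add hp0.le hq0.le, hpq, ENNReal.ofReal_one]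
      rw [Set.disjoint_left]
      intro ω h h'
      simp only [Set.mem_setOf_eq] at h h'
      omega
    exact (mem_ae_iff_prob_eq_one (hm1.union hm2)).2 hu
  let E : Finset ℕ → Set Ω := fun A =>
    ⋂ i ∈ Finset.range n, X i ⁻¹' {if i ∈ A then (1 : ℤ) else -1}
  have hE : ∀ A ∈ (Finset.range n).powerset,
      P (E A) = ENNReal.ofReal (p ^ A.card * q ^ (n - A.card)) := by
    intro A hA
    rw [Finset.mem_powerset] at hA
    have := hind.measure_inter_preimage_eq_mul (Finset.range n)
      (sets := fun i => {if i ∈ A then (1 : ℤ) else -1}) (fun i _ => measurableSet_singleton _)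
    simp only [E]
    rw [this]
    have e : ∀ i ∈ Finset.range n, P (X i ⁻¹' {if i ∈ A then (1 : ℤ) else -1})
        = ENNReal.ofReal (if i ∈ A then p else q) := by
      intro i _
      split_ifs
      · exact h1 i
      · exact h2 i
    rw [Finset.prod_congr rfl e, ← ENNReal.ofReal_prod_of_nonneg]
    · congr 1
      rw [Finset.prod_ite, Finset.prod_const, Finset.prod_const, Finset.filter_mem_eq_inter,
        Finset.inter_eq_right.2 hA, Finset.filter_notMem_eq_sdiff, Finset.card_sdiff_of_subset hA,
        Finset.card_range]
    · intro i _
      split_ifs <;> positivity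
  have hsub : P {ω | S X n ω < 0} ≤
      P (⋃ A ∈ (Finset.range n).powerset.filter (fun A => 2 * A.card < n), E A) := by
    apply measure_mono_ae
    refine hae.mono ?_
    intro ω hω
    refine fun hS => ?_
    have hS' : S X n ω < 0 := hS
    clear hS
    suffices hs : ω ∈ (⋃ A ∈ (Finset.range n).powerset.filter (fun A => 2 * A.card < n), E A) from hs
    have hval : ∀ i, X i ω = if X i ω = 1 then 1 else -1 := by
      intro i
      rcases hω i with h | h <;> simp [h]
    have hmem : ω ∈ E ((Finset.range n).filter (fun i => X i ω = 1)) := by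
      simp only [E, Set.mem_iInter]
      intro i hi
      simp only [Set.mem_preimage, Set.mem_singleton_iff, Finset.mem_filter, hi, true_and]
      exact hval i
    simp only [Set.mem_iUnion]
    refine ⟨_, ?_, hmem⟩
    simp only [Finset.mem_filter, Finset.mem_powerset, Finset.filter_subset, true_and]
    have hsum : S X n ω = 2 * ((Finset.range n).filter (fun i => X i ω = 1)).card - n := by
      unfold S
      rw [Finset.sum_congr rfl (fun i _ => hval i), Finset.sum_ite, Finset.sum_const,
        Finset.sum_const]
      have := Finset.card_filter_add_card_filter_not (s := Finset.range n) (fun i => X i ω = 1)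
      rw [Finset.card_range] at this
      simp only [nsmul_eq_mul]
      generalize ((Finset.range n).filter (fun i => X i ω = 1)).card = u at *
      generalize ((Finset.range n).filter (fun i => ¬ X i ω = 1)).card = v at *
      omega
    omega
  refine hsub.trans ((measure_biUnion_finset_le _ _).trans ?_)
  rw [Finset.sum_congr rfl (fun A hA => hE A (Finset.mem_filter.1 hA).1),
    ← ENNReal.ofReal_sum_of_nonneg (fun A _ => by positivity)]
  apply ENNReal.ofReal_le_ofReal
  rw [Finset.sum_filter, Finset.sum_filter]
  rw [Finset.sum_powerset_apply_card (fun k => if 2 * k < n then p ^ k * q ^ (n - k) else 0)]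
  simp

/-- There is a constant `C > 0` such that for every positive integer `m`,
`Σ_{n ≥ m/2} P(S_n < 0) ≤ C (4pq)^{m/4} / √m`. -/
theorem sum_prob_negative
    [MeasurableSpace Ω] (P : Measure Ω) [IsProbabilityMeasure P]
    (X : ℕ → Ω → ℤ) (p q : ℝ) (hq0 : 0 < q) (hq : q < 1/2) (hpq : p + q = 1)
    (hX : IsAsymmetricSRW P X p q) :
    ∃ C : ℝ, 0 < C ∧ ∀ m : ℕ, 1 ≤ m →
      ∑' n : {n : ℕ // (m : ℝ) / 2 ≤ (n : ℝ)}, P {ω | S X (n : ℕ) ω < 0}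
        ≤ ENNReal.ofReal (C * (4*p*q) ^ ((m : ℝ)/4) / Real.sqrt m) := by
  have hlt : q < p := by linarith
  have hp0 : 0 < p := hq0.trans hlt
  have h4 : 0 < 4 * p * q := by positivity
  have h41 : 4 * p * q < 1 := by
    have : p = 1 - q := by linarith
    subst this
    nlinarith [sq_pos_of_pos (show 0 < 1 - 2 * q by linarith)]
  have hr1 : Real.sqrt q / Real.sqrt p < 1 :=
    (div_lt_one (Real.sqrt_pos.2 hp0)).2 (Real.sqrt_lt_sqrt hq0.le hlt)
  have hD : 0 < (1 - Real.sqrt q / Real.sqrt p)⁻¹ := inv_pos.2 (by linarith)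
  have hsum := fun n hn => aux_sum p q hq0 hlt n hn
  generalize (1 - Real.sqrt q / Real.sqrt p)⁻¹ = D at *
  have ht0 : 0 < Real.sqrt (4 * p * q) := Real.sqrt_pos.2 h4
  have ht1 : Real.sqrt (4 * p * q) < 1 := by
    rw [Real.sqrt_lt' one_pos]; simpa using h41
  have hpow : ∀ m : ℕ, (4 * p * q) ^ ((m : ℝ) / 4) = (Real.sqrt (4 * p * q)) ^ ((m : ℝ) / 2) := by
    intro m
    rw [Real.sqrt_eq_rpow, ← Real.rpow_mul h4.le]
    congr 1
    ring
  simp only [hpow]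
  generalize Real.sqrt (4 * p * q) = t at *
  have hT : 0 < (1 - t)⁻¹ := inv_pos.2 (by linarith)
  refine ⟨Real.sqrt 2 * D * (1 - t)⁻¹, by positivity, ?_⟩
  intro m hm
  have hm0 : (0 : ℝ) < m := by exact_mod_cast hm
  have hsm : 0 < Real.sqrt m := Real.sqrt_pos.2 hm0
  set N := ⌈(m : ℝ) / 2⌉₊ with hN
  set K : ℝ := Real.sqrt 2 * D * t ^ ((m : ℝ) / 2) / Real.sqrt m with hK
  have hK0 : 0 ≤ K := by positivity
  have hterm : ∀ n : {n : ℕ // (m : ℝ) / 2 ≤ (n : ℝ)}, P {ω | S X (n : ℕ) ω < 0}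
      ≤ ENNReal.ofReal (K * t ^ ((n : ℕ) - N)) := by
    rintro ⟨n, hn⟩
    have hn0 : (0 : ℝ) < n := by linarith
    have hn1 : 1 ≤ n := by exact_mod_cast hn0
    refine (aux_prob P X p q hq0 hp0 hpq hX n).trans (ENNReal.ofReal_le_ofReal ?_)
    refine (hsum n hn1).trans ?_
    have hNn : N ≤ n := Nat.ceil_le.2 hn
    have e1 : t ^ n ≤ t ^ ((m : ℝ) / 2) * t ^ (n - N) := by
      calc t ^ n = t ^ N * t ^ (n - N) := by rw [← pow_add]; congr 1; omega
        _ ≤ _ := by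
          gcongr
          rw [← Real.rpow_natCast t N]
          exact Real.rpow_le_rpow_of_exponent_ge ht0 ht1.le (Nat.le_ceil _)
    have e2 : 1 / Real.sqrt n ≤ Real.sqrt 2 / Real.sqrt m := by
      rw [div_le_div_iff₀ (Real.sqrt_pos.2 hn0) hsm, one_mul, ← Real.sqrt_mul (by norm_num)]
      apply Real.sqrt_le_sqrt
      linarith
    calc t ^ n / Real.sqrt n * D = t ^ n * (1 / Real.sqrt n) * D := by ring
      _ ≤ (t ^ ((m : ℝ) / 2) * t ^ (n - N)) * (Real.sqrt 2 / Real.sqrt m) * D := by gcongr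
      _ = _ := by rw [hK]; ring
  refine (ENNReal.tsum_le_tsum hterm).trans ?_
  have hinj : Function.Injective (fun n : {n : ℕ // (m : ℝ) / 2 ≤ (n : ℝ)} => (n : ℕ) - N) := by
    rintro ⟨a, ha⟩ ⟨b, hb⟩ hab
    have := Nat.ceil_le.2 ha
    have := Nat.ceil_le.2 hb
    simp only at hab
    apply Subtype.ext
    simp only
    omega
  refine (ENNReal.tsum_comp_le_tsum_of_injective hinj
    (fun j => ENNReal.ofReal (K * t ^ j))).trans ?_
  rw [← ENNReal.ofReal_tsum_of_nonneg (fun j => by positivity)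
    ((summable_geometric_of_lt_one ht0.le ht1).mul_left K), tsum_mul_left,
    tsum_geometric_of_lt_one ht0.le ht1]
  apply ENNReal.ofReal_le_ofReal
  apply le_of_eq
  rw [hK]
  ring
end

section
/- Almost surely there exists a random integer M = M(ω) ≥ 1 such that for all m > M and all integers k ≥ 2, the indicator of C_m^k equals the indicator of B_m^k; equivalently, for all m > M and k ≥ 2, the event C_m^k occurs if and only if B_m^k occurs. -/
open MeasureTheory ProbabilityTheory Filter Set
open scoped ENNReal NNReal

variable {Ω : Type*}

/-- `hitTime X m k` is `T_m^k`, the first time at which `k` distinct sites have each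
been visited at least `m` times (`⊤` if there is no such time), with `T_m^0 = 0`. -/
noncomputable def hitTime (X : ℕ → Ω → ℤ) (m : ℕ) : ℕ → Ω → ℕ∞
  | 0, _ => 0
  | k + 1, ω =>
      sInf ((fun n : ℕ => (n : ℕ∞)) ''
        {n : ℕ | hitTime X m k ω < (n : ℕ∞) ∧ {z : ℤ | m ≤ localTime X z n ω}.ncard = k + 1})

/-- `hitSite X m k` is `L_m^k = S_{T_m^k}`, the location of the `k`-th site whose local
time reaches `m`. -/
noncomputable def hitSite (X : ℕ → Ω → ℤ) (m k : ℕ) (ω : Ω) : ℤ :=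
  S X (hitTime X m k ω).toNat ω

open scoped Classical in
/-- The event `A_m^k`: the walk does not hit `{L_m^1, …, L_m^{k-2}}` during
`[T_m^{k-1} + m/2, T_m^k ∧ T_{m+1}^1]` and does not hit `L_m^{k-1}` during
`(T_m^{k-1}, T_m^k ∧ T_{m+1}^1]`.  By convention `A_m^1` is the sure event. -/
noncomputable def Aevent (X : ℕ → Ω → ℤ) (m k : ℕ) : Set Ω :=
  if k ≤ 1 then Set.univ
  else
    {ω | (∀ n : ℕ, 2 * hitTime X m (k - 1) ω + (m : ℕ∞) ≤ 2 * (n : ℕ∞) →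
            (n : ℕ∞) ≤ min (hitTime X m k ω) (hitTime X (m + 1) 1 ω) →
            ∀ j : ℕ, 1 ≤ j → j ≤ k - 2 → S X n ω ≠ hitSite X m j ω) ∧
         (∀ n : ℕ, hitTime X m (k - 1) ω < (n : ℕ∞) →
            (n : ℕ∞) ≤ min (hitTime X m k ω) (hitTime X (m + 1) 1 ω) →
            S X n ω ≠ hitSite X m (k - 1) ω)}

/-- The event `B_m^k = A_m^1 ∩ ⋯ ∩ A_m^k`. -/
noncomputable def Bevent (X : ℕ → Ω → ℤ) (m k : ℕ) : Set Ω :=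
  ⋂ j ∈ Finset.Icc 1 k, Aevent X m j

/-- The event `C_m^k = {T_m^k < T_{m+1}^1}`, i.e. at some time there are exactly `k`
favorite sites, each with local time `m`. -/
noncomputable def Cevent (X : ℕ → Ω → ℤ) (m k : ℕ) : Set Ω :=
  {ω | hitTime X m k ω < hitTime X (m + 1) 1 ω}

/-- `G_m = sup{k : T_m^k < T_{m+1}^1}`, the maximal number of distinct sites whose
local times reach `m` before any site reaches `m + 1` visits. -/
noncomputable def Gcount (X : ℕ → Ω → ℤ) (m : ℕ) (ω : Ω) : ℕ :=
  sSup {k : ℕ | hitTime X m k ω < hitTime X (m + 1) 1 ω}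

/-! ## Deterministic part -/

lemma lt_succ (X : ℕ → Ω → ℤ) (z : ℤ) (n : ℕ) (ω : Ω) :
    localTime X z (n+1) ω = localTime X z n ω + (if S X (n+1) ω = z then 1 else 0) := by
  unfold localTime
  rw [← Finset.insert_Icc_right_eq_Icc_add_one (by omega : 1 ≤ n+1), Finset.filter_insert]
  split_ifs with h
  · rw [Finset.card_insert_of_notMem (by simp)]
  · simp

lemma lt_zero (X : ℕ → Ω → ℤ) (z : ℤ) (ω : Ω) : localTime X z 0 ω = 0 := by
  simp [localTime]

lemma lt_mono (X : ℕ → Ω → ℤ) (z : ℤ) (ω : Ω) : Monotone (fun n => localTime X z n ω) :=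
  monotone_nat_of_le_succ (fun n => by simp only [lt_succ]; omega)

/-- Sites visited at least `m` times. -/
def Vset (X : ℕ → Ω → ℤ) (m n : ℕ) (ω : Ω) : Set ℤ := {z : ℤ | m ≤ localTime X z n ω}

lemma V_mono (X : ℕ → Ω → ℤ) (m : ℕ) (ω : Ω) : Monotone (fun n => Vset X m n ω) := by
  intro a b hab z hz
  exact le_trans (show m ≤ localTime X z a ω from hz) (lt_mono X z ω hab)

lemma V_zero (X : ℕ → Ω → ℤ) (m : ℕ) (hm : 1 ≤ m) (ω : Ω) : Vset X m 0 ω = ∅ := by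
  ext z
  simp only [Vset, mem_ofPred_eq, lt_zero, mem_empty_iff_false, iff_false]
  omega

lemma V_succ_sub (X : ℕ → Ω → ℤ) (m n : ℕ) (ω : Ω) :
    Vset X m (n+1) ω ⊆ insert (S X (n+1) ω) (Vset X m n ω) := by
  intro z hz
  by_cases h : S X (n+1) ω = z
  · left; exact h.symm
  · right
    simp only [Vset, mem_ofPred_eq, lt_succ, if_neg h] at hz ⊢
    omega

lemma V_fin (X : ℕ → Ω → ℤ) (m n : ℕ) (hm : 1 ≤ m) (ω : Ω) : (Vset X m n ω).Finite := by
  induction n with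
  | zero => rw [V_zero X m hm]; exact Set.finite_empty
  | succ n ih => exact (ih.insert _).subset (V_succ_sub X m n ω)

/-- Number of sites visited at least `m` times. -/
noncomputable def Ncnt (X : ℕ → Ω → ℤ) (m n : ℕ) (ω : Ω) : ℕ := (Vset X m n ω).ncard

lemma N_mono (X : ℕ → Ω → ℤ) (m : ℕ) (hm : 1 ≤ m) (ω : Ω) :
    Monotone (fun n => Ncnt X m n ω) := fun _ b hab =>
  Set.ncard_le_ncard (V_mono X m ω hab) (V_fin X m b hm ω)

lemma N_zero (X : ℕ → Ω → ℤ) (m : ℕ) (hm : 1 ≤ m) (ω : Ω) : Ncnt X m 0 ω = 0 := by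
  simp [Ncnt, V_zero X m hm]

lemma N_succ_le (X : ℕ → Ω → ℤ) (m n : ℕ) (hm : 1 ≤ m) (ω : Ω) :
    Ncnt X m (n+1) ω ≤ Ncnt X m n ω + 1 :=
  (Set.ncard_le_ncard (V_succ_sub X m n ω) ((V_fin X m n hm ω).insert _)).trans
    (Set.ncard_insert_le _ _)

lemma V_new (X : ℕ → Ω → ℤ) (m n : ℕ) (ω : Ω)
    (h : Ncnt X m n ω < Ncnt X m (n+1) ω) :
    S X (n+1) ω ∈ Vset X m (n+1) ω ∧ S X (n+1) ω ∉ Vset X m n ω := by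
  have hne : ∃ z ∈ Vset X m (n+1) ω, z ∉ Vset X m n ω := by
    by_contra hcon
    push Not at hcon
    have : Vset X m (n+1) ω = Vset X m n ω :=
      Set.Subset.antisymm hcon (V_mono X m ω (Nat.le_succ n))
    simp only [Ncnt, this, lt_irrefl] at h
  obtain ⟨z, hz, hz'⟩ := hne
  rcases V_succ_sub X m n ω hz with h1 | h1
  · rw [← h1]; exact ⟨hz, hz'⟩
  · exact absurd h1 hz'

lemma hit_succ_le (X : ℕ → Ω → ℤ) (m k n : ℕ) (ω : Ω) :
    hitTime X m (k+1) ω ≤ (n : ℕ∞) ↔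
      ∃ n' ≤ n, hitTime X m k ω < (n' : ℕ∞) ∧ Ncnt X m n' ω = k + 1 := by
  have hdef : hitTime X m (k+1) ω = sInf ((fun n : ℕ => (n : ℕ∞)) ''
        {n : ℕ | hitTime X m k ω < (n : ℕ∞) ∧ Ncnt X m n ω = k + 1}) := rfl
  constructor
  · intro h
    rw [hdef] at h
    have hlt := lt_of_le_of_lt h (show (n : ℕ∞) < ((n+1 : ℕ) : ℕ∞) by exact_mod_cast Nat.lt_succ_self n)
    obtain ⟨_, ⟨n', hn', rfl⟩, hb⟩ := sInf_lt_iff.1 hlt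
    have : n' < n + 1 := by
      simp only at hb
      exact_mod_cast hb
    exact ⟨n', by omega, hn'⟩
  · rintro ⟨n', hn, h1, h2⟩
    rw [hdef]
    have hn2 : (n' : ℕ∞) ≤ n := by exact_mod_cast hn
    exact le_trans (sInf_le ⟨n', ⟨h1, h2⟩, rfl⟩) hn2

lemma hit_le (X : ℕ → Ω → ℤ) (m : ℕ) (hm : 1 ≤ m) (ω : Ω) (k : ℕ) : ∀ n : ℕ,
    hitTime X m k ω ≤ (n : ℕ∞) ↔ k ≤ Ncnt X m n ω := by
  induction k with
  | zero => intro n; simp [hitTime]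
  | succ k ih =>
    intro n
    rw [hit_succ_le]
    constructor
    · rintro ⟨n', hn, -, h2⟩
      rw [← h2]; exact N_mono X m hm ω hn
    · intro h
      classical
      have hex : ∃ n', k + 1 ≤ Ncnt X m n' ω := ⟨n, h⟩
      have hs := Nat.find_spec hex
      have hle := Nat.find_min' hex h
      have hmin := fun j => Nat.find_min hex (m := j)
      generalize Nat.find hex = t at *
      cases t with
      | zero => rw [N_zero X m hm] at hs; omega
      | succ t =>
        have h1 := hmin t (Nat.lt_succ_self t)
        have h2 := N_succ_le X m t hm ω
        refine ⟨t+1, hle, ?_, by omega⟩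
        refine lt_of_le_of_lt ((ih t).2 (by omega)) ?_
        exact_mod_cast Nat.lt_succ_self t

lemma hit_mono (X : ℕ → Ω → ℤ) (m : ℕ) (hm : 1 ≤ m) (ω : Ω) {j k : ℕ} (h : j ≤ k) :
    hitTime X m j ω ≤ hitTime X m k ω := by
  rcases eq_or_ne (hitTime X m k ω) ⊤ with h1 | h1
  · rw [h1]; exact le_top
  · lift hitTime X m k ω to ℕ using h1 with t ht
    rw [hit_le X m hm]
    exact h.trans ((hit_le X m hm ω k t).1 ht.symm.le)

/-- at the hitting time -/
lemma hit_spec (X : ℕ → Ω → ℤ) (m : ℕ) (hm : 1 ≤ m) (ω : Ω) (k t : ℕ) (hk : 1 ≤ k)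
    (ht : hitTime X m k ω = t) :
    ∃ t', t = t' + 1 ∧ hitSite X m k ω = S X t ω ∧ S X t ω ∈ Vset X m t ω ∧
      S X t ω ∉ Vset X m t' ω ∧ k ≤ Ncnt X m t ω ∧ Ncnt X m t' ω < k := by
  have h1 := (hit_le X m hm ω k t).1 ht.le
  cases t with
  | zero => rw [N_zero X m hm] at h1; omega
  | succ t =>
    have h2 : Ncnt X m t ω < k := by
      by_contra hcon
      have := (hit_le X m hm ω k t).2 (by omega)
      rw [ht] at this
      have : t + 1 ≤ t := by exact_mod_cast this
      omega
    obtain ⟨a, b⟩ := V_new X m t ω (by omega)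
    exact ⟨t, rfl, by simp only [hitSite, ht]; rfl, a, b, h1, h2⟩

lemma hit_revisit (X : ℕ → Ω → ℤ) (m : ℕ) (hm : 1 ≤ m) (ω : Ω) (i n : ℕ) (hi : 1 ≤ i)
    (h : hitTime X m i ω < n) (hS : S X n ω = hitSite X m i ω) :
    hitTime X (m+1) 1 ω ≤ n := by
  have hne : hitTime X m i ω ≠ ⊤ := (lt_of_lt_of_le h le_top).ne
  obtain ⟨t, ht⟩ := ENat.ne_top_iff_exists.1 hne
  obtain ⟨t', -, h2, h3, -⟩ := hit_spec X m hm ω i t hi ht.symm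
  rw [← ht] at h
  have htn : t < n := by exact_mod_cast h
  obtain ⟨n, rfl⟩ : ∃ n', n = n' + 1 := ⟨n-1, by omega⟩
  rw [hit_le X (m+1) (by omega)]
  have h4 : S X t ω ∈ Vset X (m+1) (n+1) ω := by
    have := lt_mono X (S X t ω) ω (show t ≤ n by omega)
    simp only [Vset, mem_ofPred_eq, lt_succ, hS, h2] at h3 this ⊢
    simp only [if_true]
    omega
  exact (Set.ncard_pos (V_fin X (m+1) (n+1) (by omega) ω)).2 ⟨_, h4⟩

lemma V_hit (X : ℕ → Ω → ℤ) (m : ℕ) (hm : 1 ≤ m) (ω : Ω) (z : ℤ) (n : ℕ)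
    (h : z ∈ Vset X m n ω) : ∃ j, 1 ≤ j ∧ j ≤ Ncnt X m n ω ∧ hitSite X m j ω = z := by
  classical
  have hex : ∃ n', z ∈ Vset X m n' ω := ⟨n, h⟩
  have hs := Nat.find_spec hex
  have hle := Nat.find_min' hex h
  have hmin := fun j => Nat.find_min hex (m := j)
  generalize Nat.find hex = t at *
  cases t with
  | zero => rw [V_zero X m hm] at hs; exact absurd hs (Set.notMem_empty _)
  | succ t =>
    have h1 := hmin t (Nat.lt_succ_self t)
    have hz : z = S X (t+1) ω := by
      rcases V_succ_sub X m t ω hs with h2 | h2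
      · exact h2
      · exact absurd h2 h1
    have hlt : Ncnt X m t ω < Ncnt X m (t+1) ω := by
      apply Set.ncard_lt_ncard _ (V_fin X m (t+1) hm ω)
      exact ⟨V_mono X m ω (Nat.le_succ t), fun hc => h1 (hc hs)⟩
    refine ⟨Ncnt X m (t+1) ω, by omega, N_mono X m hm ω hle, ?_⟩
    have e : hitTime X m (Ncnt X m (t+1) ω) ω = ((t+1 : ℕ) : ℕ∞) := by
      apply le_antisymm
      · rw [hit_le X m hm]
      · by_contra hc
        push Not at hc
        obtain ⟨s, hs'⟩ := ENat.ne_top_iff_exists.1 (lt_of_lt_of_le hc le_top).ne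
        rw [← hs'] at hc
        have : s < t + 1 := by exact_mod_cast hc
        have h5 := (hit_le X m hm ω _ s).1 hs'.symm.le
        have := N_mono X m hm ω (show s ≤ t by omega)
        simp only at this
        omega
    rw [hz, hitSite, e]; rfl

lemma S_diff (X : ℕ → Ω → ℤ) (ω : Ω) (hX : ∀ i, |X i ω| ≤ 1) (a b : ℕ) :
    |S X (a+b) ω - S X a ω| ≤ b := by
  induction b with
  | zero => simp
  | succ b ih =>
    have : S X (a + (b+1)) ω = S X (a+b) ω + X (a+b) ω := by
      simp only [S, ← add_assoc, Finset.sum_range_succ]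
    have h := hX (a+b)
    rw [this]
    rw [abs_le] at *
    push_cast
    constructor <;> linarith [h.1, h.2, ih.1, ih.2]

lemma lt_pos_abs (X : ℕ → Ω → ℤ) (ω : Ω) (hX : ∀ i, |X i ω| ≤ 1) (z : ℤ) (n : ℕ)
    (h : 1 ≤ localTime X z n ω) : |z| ≤ n := by
  obtain ⟨k, hk⟩ := Finset.card_pos.1 h
  rw [Finset.mem_filter, Finset.mem_Icc] at hk
  have := S_diff X ω hX 0 k
  have h0 : S X 0 ω = 0 := by simp [S]
  rw [zero_add, h0, sub_zero, hk.2] at this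
  have h3 : (k : ℤ) ≤ n := by exact_mod_cast hk.1.2
  linarith

lemma C_imp_B (X : ℕ → Ω → ℤ) (m : ℕ) (hm : 1 ≤ m) (ω : Ω) (k : ℕ)
    (h : ω ∈ Cevent X m k) : ω ∈ Bevent X m k := by
  have h : hitTime X m k ω < hitTime X (m+1) 1 ω := h
  simp only [Bevent, mem_iInter, Finset.mem_Icc]
  rintro j ⟨hj1, hjk⟩
  unfold Aevent
  split_ifs with hj
  · trivial
  have key : ∀ i n : ℕ, 1 ≤ i → hitTime X m i ω < n →
      (n : ℕ∞) ≤ min (hitTime X m j ω) (hitTime X (m+1) 1 ω) →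
      S X n ω ≠ hitSite X m i ω := by
    intro i n hi h1 h2 h3
    have h4 := hit_revisit X m hm ω i n hi h1 h3
    have h5 := (le_min_iff.1 h2).1.trans (hit_mono X m hm ω hjk)
    exact absurd (h4.trans h5) (not_le.2 h)
  refine ⟨?_, ?_⟩
  · intro n h1 h2 i hi hi2
    refine key i n hi ?_ h2
    have h6 : hitTime X m (j-1) ω ≠ ⊤ := by
      intro hc
      rw [hc] at h1
      have : (2 : ℕ∞) * ⊤ + m = ⊤ := by simp [ENat.mul_top]
      rw [this, top_le_iff] at h1
      exact absurd h1 (by exact_mod_cast ENat.natCast_ne_top (2*n))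
    obtain ⟨t, ht⟩ := ENat.ne_top_iff_exists.1 h6
    have h7 := hit_mono X m hm ω (show i ≤ j-1 by omega)
    rw [← ht] at h1 h7
    have h8 : 2 * t + m ≤ 2 * n := by exact_mod_cast h1
    refine lt_of_le_of_lt h7 ?_
    have : t < n := by omega
    exact_mod_cast this
  · intro n h1 h2
    exact key (j-1) n (by omega) h1 h2

lemma B_imp_C (X : ℕ → Ω → ℤ) (m : ℕ) (hm : 1 ≤ m) (ω : Ω) (hX : ∀ i, |X i ω| ≤ 1) (N : ℕ)
    (h1 : ∃ z, m + 1 ≤ localTime X z N ω)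
    (h2 : ∀ a b : ℤ, a < b → b ≤ a + m → m ≤ localTime X a N ω → ¬ m ≤ localTime X b N ω)
    (k : ℕ) (hk : 1 ≤ k) (h : ω ∈ Bevent X m k) : ω ∈ Cevent X m k := by
  show hitTime X m k ω < hitTime X (m+1) 1 ω
  have hτ : hitTime X (m+1) 1 ω ≤ N := by
    rw [hit_le X (m+1) (by omega)]
    exact (Set.ncard_pos (V_fin X (m+1) N (by omega) ω)).2 h1
  obtain ⟨t, ht⟩ := ENat.ne_top_iff_exists.1 (lt_of_le_of_lt hτ (ENat.natCast_lt_top N)).ne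
  obtain ⟨t', rfl, -, hz1, hz2, -⟩ := hit_spec X (m+1) (by omega) ω 1 t le_rfl ht.symm
  have hz3 : S X (t'+1) ω ∈ Vset X m t' ω := by
    simp only [Vset, mem_ofPred_eq, lt_succ, if_true] at hz1 ⊢
    omega
  have htN : t' + 1 ≤ N := by rw [← ht] at hτ; exact_mod_cast hτ
  rw [← ht]
  induction k, hk using Nat.le_induction with
  | base =>
    refine lt_of_le_of_lt ((hit_le X m hm ω 1 t').2 ?_) (by exact_mod_cast Nat.lt_succ_self t')
    exact (Set.ncard_pos (V_fin X m t' hm ω)).2 ⟨_, hz3⟩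
  | succ k hk ih =>
    have hB : ω ∈ Bevent X m k := by
      simp only [Bevent, mem_iInter, Finset.mem_Icc] at h ⊢
      exact fun j hj => h j ⟨hj.1, by omega⟩
    have hC := ih hB
    by_contra hcon
    push Not at hcon
    have hA : ω ∈ Aevent X m (k+1) := by
      simp only [Bevent, mem_iInter, Finset.mem_Icc] at h
      exact h (k+1) ⟨by omega, le_rfl⟩
    rw [Aevent, if_neg (by omega)] at hA
    obtain ⟨hA1, hA2⟩ := hA
    simp only [Nat.add_sub_cancel] at hA1 hA2
    have hmin : ((t'+1 : ℕ) : ℕ∞) ≤ min (hitTime X m (k+1) ω) (hitTime X (m+1) 1 ω) :=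
      le_min hcon ht.le
    have hA2' := hA2 (t'+1) hC hmin
    obtain ⟨j, hj1, hj2, hj3⟩ := V_hit X m hm ω _ t' hz3
    have hjk : j ≤ k := by
      by_contra hc
      have h5 := (hit_le X m hm ω (k+1) t').2 (by omega)
      have h6 := hcon.trans h5
      have : t' + 1 ≤ t' := by exact_mod_cast h6
      omega
    have hjk' : j ≠ k := by
      rintro rfl
      exact hA2' hj3.symm
    have hA1' : ¬ (2 * hitTime X m k ω + (m : ℕ∞) ≤ 2 * ((t'+1 : ℕ) : ℕ∞)) := fun hc =>
      hA1 (t'+1) hc hmin j hj1 (by omega) hj3.symm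
    obtain ⟨s, hs⟩ := ENat.ne_top_iff_exists.1 (lt_of_lt_of_le hC le_top).ne
    obtain ⟨s', -, hs2, hs3, -⟩ := hit_spec X m hm ω k s hk hs.symm
    rw [← hs] at hA1' hC
    have hC' : s < t' + 1 := by exact_mod_cast hC
    have hA1'' : ¬ (2 * s + m ≤ 2 * (t'+1)) := fun hc => hA1' (by exact_mod_cast hc)
    have hd := S_diff X ω hX s (t'+1-s)
    rw [show s + (t'+1-s) = t'+1 by omega] at hd
    rw [hs2] at hA2'
    have e1 : m ≤ localTime X (S X (t'+1) ω) N ω := V_mono X m ω (show t' ≤ N by omega) hz3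
    have e2 : m ≤ localTime X (S X s ω) N ω := V_mono X m ω (show s ≤ N by omega) hs3
    have hd' := abs_le.1 hd
    rcases lt_or_gt_of_ne hA2' with hlt | hlt
    · exact h2 _ _ hlt (by omega) e1 e2
    · exact h2 _ _ hlt (by omega) e2 e1

/-! ## Finite-horizon expectations -/

/-- Expectation of a functional of the first `n` steps. -/
noncomputable def Ex (p q : ℝ) : ℕ → (List ℤ → ℝ) → ℝ
  | 0, f => f []
  | n+1, f => p * Ex p q n (fun l => f (1 :: l)) + q * Ex p q n (fun l => f ((-1) :: l))

lemma Ex_mono (p q : ℝ) (hp : 0 ≤ p) (hq : 0 ≤ q) (n : ℕ) : ∀ (f g : List ℤ → ℝ),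
    (∀ l, f l ≤ g l) → Ex p q n f ≤ Ex p q n g := by
  induction n with
  | zero => intro f g h; exact h []
  | succ n ih =>
    intro f g h
    exact add_le_add (mul_le_mul_of_nonneg_left (ih _ _ fun l => h _) hp)
      (mul_le_mul_of_nonneg_left (ih _ _ fun l => h _) hq)

lemma Ex_mul (p q : ℝ) (c : ℝ) (n : ℕ) : ∀ (f : List ℤ → ℝ),
    Ex p q n (fun l => c * f l) = c * Ex p q n f := by
  induction n with
  | zero => intro f; rfl
  | succ n ih =>
    intro f
    simp only [Ex, ih]
    ring

lemma Ex_sub (p q : ℝ) (n : ℕ) : ∀ (f g : List ℤ → ℝ),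
    Ex p q n (fun l => f l - g l) = Ex p q n f - Ex p q n g := by
  induction n with
  | zero => intro f g; rfl
  | succ n ih =>
    intro f g
    simp only [Ex, ih]
    ring

lemma Ex_one (p q : ℝ) (h : p + q = 1) (n : ℕ) : Ex p q n (fun _ => 1) = 1 := by
  induction n with
  | zero => rfl
  | succ n ih => simp only [Ex, ih]; linarith

lemma Ex_append (p q : ℝ) (n m : ℕ) : ∀ (f : List ℤ → ℝ),
    Ex p q (n+m) f = Ex p q n (fun l => Ex p q m (fun l' => f (l ++ l'))) := by
  induction n with
  | zero => intro f; simp [Ex]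
  | succ n ih =>
    intro f
    rw [show n + 1 + m = (n + m) + 1 by omega]
    simp only [Ex, ih, List.cons_append]

/-- First `n` steps. -/
def lst (X : ℕ → Ω → ℤ) (n : ℕ) (ω : Ω) : List ℤ := (List.range n).map (fun i => X i ω)

lemma lst_ofFn (X : ℕ → Ω → ℤ) (n : ℕ) (ω : Ω) :
    lst X n ω = List.ofFn (fun i : Fin n => X i ω) := by
  apply List.ext_getElem <;> simp [lst]

lemma lst_succ (X : ℕ → Ω → ℤ) (n : ℕ) (ω : Ω) :
    lst X (n+1) ω = X 0 ω :: lst (fun i => X (i+1)) n ω := by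
  simp [lst, List.range_succ_eq_map, List.map_map, Function.comp_def]

/-- visits to `a` of the walk started at `x` following the steps. -/
def vis (a : ℤ) : ℤ → List ℤ → ℕ
  | _, [] => 0
  | x, y :: l => (if x + y = a then 1 else 0) + vis a (x+y) l

lemma vis_append (a : ℤ) (l l' : List ℤ) : ∀ x, 
    vis a x (l ++ l') = vis a x l + vis a (x + l.sum) l' := by
  induction l with
  | nil => intro x; simp [vis]
  | cons y l ih => intro x; simp [vis, ih, add_assoc]

lemma vis_shift (a c : ℤ) (l : List ℤ) : ∀ x, vis (a+c) (x+c) l = vis a x l := by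
  induction l with
  | nil => intro x; rfl
  | cons y l ih =>
    intro x
    simp only [vis]
    rw [show x + c + y = (x + y) + c by ring, ih]
    simp

lemma vis_snoc (a : ℤ) (l : List ℤ) (y x : ℤ) :
    vis a x (l ++ [y]) = vis a x l + (if x + l.sum + y = a then 1 else 0) := by
  rw [vis_append]; simp [vis]

lemma lst_snoc (X : ℕ → Ω → ℤ) (n : ℕ) (ω : Ω) : lst X (n+1) ω = lst X n ω ++ [X n ω] := by
  simp [lst, List.range_succ]

lemma lst_sum (X : ℕ → Ω → ℤ) (n : ℕ) (ω : Ω) : (lst X n ω).sum = S X n ω := by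
  induction n with
  | zero => simp [lst, S]
  | succ n ih => simp only [S] at ih; simp [lst_snoc, ih, S, Finset.sum_range_succ]

lemma lt_eq_vis (X : ℕ → Ω → ℤ) (a : ℤ) (n : ℕ) (ω : Ω) :
    localTime X a n ω = vis a 0 (lst X n ω) := by
  induction n with
  | zero => simp [lt_zero, lst, vis]
  | succ n ih =>
    rw [lt_succ, ih, lst_snoc, vis_snoc, lst_sum]
    simp [S, Finset.sum_range_succ]

open scoped Classical in
/-- Probability of a finite-horizon event. -/
noncomputable def Pr (p q : ℝ) (n : ℕ) (A : List ℤ → Prop) : ℝ :=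
  Ex p q n (fun l => if A l then 1 else 0)

lemma Pr_nonneg (p q : ℝ) (hp : 0 ≤ p) (hq : 0 ≤ q) (n : ℕ) (A : List ℤ → Prop) :
    0 ≤ Pr p q n A := by
  have h := Ex_mono p q hp hq n (fun _ => 0 * 1) _
    (fun l => show (0:ℝ) * 1 ≤ (open scoped Classical in if A l then (1:ℝ) else 0) by split_ifs <;> norm_num)
  rw [Ex_mul, zero_mul] at h
  exact h

lemma Pr_succ (p q : ℝ) (n : ℕ) (A : List ℤ → Prop) :
    Pr p q (n+1) A = p * Pr p q n (fun l => A (1::l)) + q * Pr p q n (fun l => A ((-1)::l)) := rfl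

lemma srw_shift [MeasurableSpace Ω] {P : Measure Ω} {X : ℕ → Ω → ℤ} {p q : ℝ}
    (hX : IsAsymmetricSRW P X p q) : IsAsymmetricSRW P (fun i => X (i+1)) p q :=
  ⟨fun _ => hX.1 _, hX.2.1.precomp (g := fun i => i+1) (add_left_injective 1),
    fun _ => hX.2.2.1 _, fun _ => hX.2.2.2 _⟩

lemma srw_pm [MeasurableSpace Ω] {P : Measure Ω} [IsProbabilityMeasure P] {X : ℕ → Ω → ℤ} {p q : ℝ}
    (hp : 0 ≤ p) (hq : 0 ≤ q) (hpq : p + q = 1)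
    (hX : IsAsymmetricSRW P X p q) (i : ℕ) : ∀ᵐ ω ∂P, X i ω = 1 ∨ X i ω = -1 := by
  have h1 : MeasurableSet {ω | X i ω = 1} := hX.1 i (measurableSet_singleton 1)
  have h2 : MeasurableSet {ω | X i ω = -1} := hX.1 i (measurableSet_singleton (-1))
  have hd : Disjoint {ω | X i ω = 1} {ω | X i ω = -1} := by
    rw [Set.disjoint_left]
    intro ω h h'
    have h : X i ω = 1 := h
    have h' : X i ω = -1 := h'
    omega
  have h3 := measure_union (μ := P) hd h2
  rw [hX.2.2.1, hX.2.2.2, ← ENNReal.ofReal_add hp hq, hpq, ENNReal.ofReal_one] at h3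
  have h4 := (prob_compl_eq_zero_iff (h1.union h2)).2 h3
  rw [ae_iff]
  convert h4 using 2
  ext ω
  simp

lemma lst_meas [MeasurableSpace Ω] {X : ℕ → Ω → ℤ} (hX : ∀ i, Measurable (X i)) (n : ℕ) 
    (A : List ℤ → Prop) : MeasurableSet {ω | A (lst X n ω)} := by
  let φ : (Fin n → ℤ) → List ℤ := fun v => List.ofFn v
  have h1 : Measurable (fun ω => (fun i : Fin n => X i ω)) := measurable_pi_lambda _ fun i => hX i
  have h2 : MeasurableSet {v : Fin n → ℤ | A (φ v)} := (Set.to_countable _).measurableSet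
  have h3 := h1 h2
  convert h3 using 1
  ext ω
  simp only [mem_ofPred_eq, mem_preimage, φ, lst]
  rw [← lst_ofFn]
  rfl

lemma srw_indep [MeasurableSpace Ω] {P : Measure Ω} [IsProbabilityMeasure P] {X : ℕ → Ω → ℤ} {p q : ℝ}
    (hX : IsAsymmetricSRW P X p q) (n : ℕ) (c : ℤ) (A : List ℤ → Prop) :
    P {ω | X 0 ω = c ∧ A (lst (fun i => X (i+1)) n ω)} = 
      P {ω | X 0 ω = c} * P {ω | A (lst (fun i => X (i+1)) n ω)} := by
  have h := hX.2.1.indepFun_finset {0} (Finset.Icc 1 n) (by simp) hX.1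
  have h' := h.measure_inter_preimage_eq_mul
    {v | v ⟨0, by simp⟩ = c} 
    {v : (i : (Finset.Icc 1 n)) → ℤ | A (List.ofFn (fun i : Fin n => v ⟨i+1, by simp⟩))} 
    (Set.to_countable _).measurableSet (Set.to_countable _).measurableSet
  have e : ∀ ω, lst (fun i => X (i+1)) n ω = List.ofFn (fun i : Fin n => X (i+1) ω) := by
    intro ω
    exact lst_ofFn _ n ω
  simp only [e]
  exact h'

lemma P_eq_Pr [MeasurableSpace Ω] (P : Measure Ω) [IsProbabilityMeasure P] (p q : ℝ)
    (hp : 0 ≤ p) (hq : 0 ≤ q) (hpq : p + q = 1) (n : ℕ) :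
    ∀ (X : ℕ → Ω → ℤ) (_ : IsAsymmetricSRW P X p q) (A : List ℤ → Prop),
      P {ω | A (lst X n ω)} = ENNReal.ofReal (Pr p q n A) := by
  induction n with
  | zero =>
    intro X hX A
    by_cases h : A [] <;> simp [lst, Pr, Ex, h]
  | succ n ih =>
    intro X hX A
    have hX' := srw_shift hX
    have e : {ω | A (lst X (n+1) ω)} =ᵐ[P] 
        ({ω | X 0 ω = 1 ∧ A (1 :: lst (fun i => X (i+1)) n ω)} ∪
         {ω | X 0 ω = -1 ∧ A ((-1) :: lst (fun i => X (i+1)) n ω)} : Set Ω) := by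
      filter_upwards [srw_pm hp hq hpq hX 0] with ω hω
      apply propext
      show A (lst X (n+1) ω) ↔ (X 0 ω = 1 ∧ A (1 :: lst (fun i => X (i+1)) n ω)) ∨
        (X 0 ω = -1 ∧ A ((-1) :: lst (fun i => X (i+1)) n ω))
      rw [lst_succ]
      rcases hω with h | h <;> simp [h]
    rw [measure_congr e, measure_union]
    · rw [srw_indep hX n 1 (fun l => A (1::l)), srw_indep hX n (-1) (fun l => A ((-1)::l)),
        ih _ hX' (fun l => A (1::l)), ih _ hX' (fun l => A ((-1)::l)), hX.2.2.1, hX.2.2.2, Pr_succ,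
        ENNReal.ofReal_add, ENNReal.ofReal_mul hp, ENNReal.ofReal_mul hq]
      · exact mul_nonneg hp (Pr_nonneg p q hp hq _ _)
      · exact mul_nonneg hq (Pr_nonneg p q hp hq _ _)
    · rw [Set.disjoint_left]
      rintro ω ⟨h, -⟩ ⟨h', -⟩
      omega
    · exact (hX.1 0 (measurableSet_singleton (-1))).inter (lst_meas hX'.1 n (fun l => A ((-1)::l)))

/-! ## Potential-theoretic bounds -/

/-- hitting probability of `0`. -/
noncomputable def g0 (r : ℝ) (x : ℤ) : ℝ := if x ≤ 0 then 1 else r ^ x.toNat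

lemma g0_neg (r : ℝ) (x : ℤ) (h : x ≤ 0) : g0 r x = 1 := if_pos h

lemma g0_nat (r : ℝ) (k : ℕ) : g0 r (k : ℤ) = r ^ k := by
  unfold g0
  split_ifs with h
  · have : k = 0 := by omega
    simp [this]
  · simp

lemma g0_nonneg (r : ℝ) (hr : 0 ≤ r) (x : ℤ) : 0 ≤ g0 r x := by
  unfold g0; split_ifs <;> positivity

lemma g0_le_one (r : ℝ) (hr : 0 ≤ r) (hr1 : r ≤ 1) (x : ℤ) : g0 r x ≤ 1 := by
  unfold g0; split_ifs
  · exact le_rfl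
  · exact pow_le_one₀ hr hr1

lemma g0_harm (p q r : ℝ) (hpq : p + q = 1) (hr : p * r = q) (x : ℤ) (hx : x ≠ 0) :
    p * g0 r (x+1) + q * g0 r (x-1) = g0 r x := by
  rcases lt_or_gt_of_ne hx with h | h
  · rw [g0_neg r _ (by omega), g0_neg r _ (by omega), g0_neg r _ (by omega)]; linarith
  · obtain ⟨k, rfl⟩ : ∃ k : ℕ, x = (k : ℤ) + 1 := ⟨(x-1).toNat, by omega⟩
    have e1 : ((k : ℤ) + 1 + 1) = ((k+2 : ℕ) : ℤ) := by push_cast; ring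
    have e2 : ((k : ℤ) + 1 - 1) = ((k : ℕ) : ℤ) := by push_cast; ring
    have e3 : ((k : ℤ) + 1) = ((k+1 : ℕ) : ℤ) := by push_cast; ring
    rw [e1, e2, e3, g0_nat, g0_nat, g0_nat]
    have : p * r ^ (k+2) = q * r^(k+1) := by rw [← hr]; ring
    have h2 : q * r ^ k = p * r^(k+1) := by rw [← hr]; ring
    rw [this, h2, ← add_mul, add_comm q p, hpq, one_mul]

lemma g0_zero (p q r : ℝ) (hr : p * r = q) :
    p * g0 r (0+1) + q * g0 r (0-1) = 2 * q := by
  have := g0_nat r 1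
  rw [g0_neg r (0-1) (by omega), show (0:ℤ)+1 = ((1:ℕ):ℤ) by norm_num, this, pow_one, hr]; ring

lemma g0_sup (p q r : ℝ) (hpq : p + q = 1) (hr : p * r = q) (hq : q < 1/2) (x : ℤ) :
    p * g0 r (x+1) + q * g0 r (x-1) ≤ g0 r x := by
  by_cases h : x = 0
  · subst h; rw [g0_zero p q r hr, g0_neg r 0 le_rfl]; linarith
  · exact (g0_harm p q r hpq hr x h).le

lemma two_site (p q r δ s u : ℝ) (hp : 0 ≤ p) (hq0 : 0 ≤ q) (hq : q < 1/2) (hpq : p + q = 1)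
    (hr : p * r = q) (hr0 : 0 ≤ r) (hr1 : r ≤ 1)
    (hδ : 0 < δ) (hs : 1 ≤ s) (hu : 1 ≤ u) (hs2 : s * (1 + 2*q + δ) ≤ 2 + δ)
    (hu2 : u * (r + 2*q + δ) ≤ 1 + r + δ) (a b : ℤ) (hab : a < b) (n : ℕ) : ∀ x : ℤ,
    (if x = a then s else if x = b then u else 1) *
      (δ * Ex p q n (fun l => s ^ vis a x l * u ^ vis b x l)) ≤
      s * u * (g0 r (x-a) + g0 r (x-b) + δ) := by
  have hW : ∀ x : ℤ, (if x = a then s else if x = b then u else 1) ≤ s * u ∧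
      1 ≤ (if x = a then s else if x = b then u else 1) := by
    intro x
    split_ifs <;> constructor <;> nlinarith
  have hsu : 1 ≤ s * u := by nlinarith
  induction n with
  | zero =>
    intro x
    simp only [Ex, vis, pow_zero, mul_one]
    have h1 := g0_nonneg r hr0 (x-a)
    have h2 := g0_nonneg r hr0 (x-b)
    exact mul_le_mul (hW x).1 (by linarith) hδ.le (by linarith)
  | succ n ih =>
    intro x
    have hstep : ∀ y : ℤ, Ex p q n (fun l => s ^ vis a x (y::l) * u ^ vis b x (y::l)) =
        (if x+y = a then s else if x+y = b then u else 1) *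
          Ex p q n (fun l => s ^ vis a (x+y) l * u ^ vis b (x+y) l) := by
      intro y
      rw [← Ex_mul]
      congr 1
      funext l
      simp only [vis]
      by_cases h1 : x + y = a
      · have h2 : x + y ≠ b := by omega
        have h3 : a ≠ b := by omega
        simp [h1, h3, pow_add]; ring
      · by_cases h2 : x + y = b
        · have h3 : b ≠ a := by omega
          simp [h2, h3, pow_add]; ring
        · simp [h1, h2]
    have hp1 := ih (x+1)
    have hm1 := ih (x+(-1))
    simp only [Ex, hstep]
    set E1 := Ex p q n (fun l => s ^ vis a (x+1) l * u ^ vis b (x+1) l)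
    set E2 := Ex p q n (fun l => s ^ vis a (x+(-1)) l * u ^ vis b (x+(-1)) l)
    set W1 := (if x+1 = a then s else if x+1 = b then u else 1)
    set W2 := (if x+(-1) = a then s else if x+(-1) = b then u else 1)
    have hG : (if x = a then s else if x = b then u else 1) *
        (p * (g0 r (x+1-a) + g0 r (x+1-b) + δ) + q * (g0 r (x+(-1)-a) + g0 r (x+(-1)-b) + δ))
        ≤ g0 r (x-a) + g0 r (x-b) + δ := by
      rw [show x + 1 - a = (x - a) + 1 by ring, show x + 1 - b = (x - b) + 1 by ring,
        show x + (-1) - a = (x - a) - 1 by ring, show x + (-1) - b = (x - b) - 1 by ring]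
      have e : p * (g0 r ((x-a)+1) + g0 r ((x-b)+1) + δ) + q * (g0 r ((x-a)-1) + g0 r ((x-b)-1) + δ)
        = (p * g0 r ((x-a)+1) + q * g0 r ((x-a)-1)) + (p * g0 r ((x-b)+1) + q * g0 r ((x-b)-1)) + δ := by
        linear_combination δ * hpq
      rw [e]
      by_cases h1 : x = a
      · subst h1
        rw [if_pos rfl, sub_self, g0_zero p q r hr, g0_harm p q r hpq hr (x-b) (by omega),
          g0_neg r 0 le_rfl, g0_neg r (x-b) (by omega)]
        linarith
      · rw [if_neg h1]
        by_cases h2 : x = b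
        · subst h2
          rw [if_pos rfl, sub_self, g0_zero p q r hr, g0_harm p q r hpq hr (x-a) (by omega),
            g0_neg r 0 le_rfl]
          obtain ⟨k, hk⟩ : ∃ k : ℕ, x - a = ((k + 1 : ℕ) : ℤ) := ⟨(x-a-1).toNat, by omega⟩
          rw [hk, g0_nat]
          have hρ : r^(k+1) ≤ r := by
            rw [pow_succ]; exact mul_le_of_le_one_left hr0 (pow_le_one₀ hr0 hr1)
          nlinarith
        · rw [if_neg h2, g0_harm p q r hpq hr (x-a) (by omega),
            g0_harm p q r hpq hr (x-b) (by omega)]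
          linarith
    have hW1 := (hW x).2
    set W := (if x = a then s else if x = b then u else 1)
    calc W * (δ * (p * (W1 * E1) + q * (W2 * E2)))
        = W * (p * (W1 * (δ * E1)) + q * (W2 * (δ * E2))) := by ring
      _ ≤ W * (p * (s * u * (g0 r (x+1-a) + g0 r (x+1-b) + δ)) +
            q * (s * u * (g0 r (x+(-1)-a) + g0 r (x+(-1)-b) + δ))) := by
          apply mul_le_mul_of_nonneg_left _ (by linarith)
          exact add_le_add (mul_le_mul_of_nonneg_left hp1 hp) (mul_le_mul_of_nonneg_left hm1 hq0)
      _ = s * u * (W * (p * (g0 r (x+1-a) + g0 r (x+1-b) + δ) +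
            q * (g0 r (x+(-1)-a) + g0 r (x+(-1)-b) + δ))) := by ring
      _ ≤ _ := mul_le_mul_of_nonneg_left hG (by linarith)

lemma two_site_Pr (p q r δ s u : ℝ) (hp : 0 ≤ p) (hq0 : 0 ≤ q) (hq : q < 1/2) (hpq : p + q = 1)
    (hr : p * r = q) (hr0 : 0 ≤ r) (hr1 : r ≤ 1)
    (hδ : 0 < δ) (hs : 1 ≤ s) (hu : 1 ≤ u) (hs2 : s * (1 + 2*q + δ) ≤ 2 + δ)
    (hu2 : u * (r + 2*q + δ) ≤ 1 + r + δ) (a b : ℤ) (hab : a < b) (n m : ℕ) :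
    Pr p q n (fun l => m ≤ vis a 0 l ∧ m ≤ vis b 0 l) ≤
      (s * u * (2 + δ) / δ) * ((s*u)⁻¹)^m := by
  have h := two_site p q r δ s u hp hq0 hq hpq hr hr0 hr1 hδ hs hu hs2 hu2 a b hab n 0
  set E := Ex p q n (fun l => s ^ vis a 0 l * u ^ vis b 0 l)
  have hsu : 1 ≤ s * u := by nlinarith
  have h1 : (s*u)^m * Pr p q n (fun l => m ≤ vis a 0 l ∧ m ≤ vis b 0 l) ≤ E := by
    unfold Pr
    rw [← Ex_mul]
    apply Ex_mono p q hp hq0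
    intro l
    split_ifs with hl
    · rw [mul_one, mul_pow]
      exact mul_le_mul (pow_le_pow_right₀ hs hl.1) (pow_le_pow_right₀ hu hl.2) (by positivity)
        (by positivity)
    · rw [mul_zero]; positivity
  have h0 := Pr_nonneg p q hp hq0 n (fun l => m ≤ vis a 0 l ∧ m ≤ vis b 0 l)
  have hpos : 0 < (s*u)^m := by positivity
  have hE : 0 ≤ E := le_trans (by positivity) h1
  have hE2 : δ * E ≤ s * u * (2 + δ) := by
    have hg1 := g0_le_one r hr0 hr1 (0-a)
    have hg2 := g0_le_one r hr0 hr1 (0-b)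
    have hW : 1 ≤ (if (0:ℤ) = a then s else if (0:ℤ) = b then u else 1) := by split_ifs <;> linarith
    have h3 : δ * E ≤ s * u * (g0 r (0-a) + g0 r (0-b) + δ) :=
      le_trans (le_mul_of_one_le_left (by positivity) hW) h
    refine h3.trans (mul_le_mul_of_nonneg_left (by linarith) (by linarith))
  rw [inv_pow, ← div_eq_mul_inv, le_div_iff₀ hpos, le_div_iff₀ hδ]
  nlinarith

lemma Pr_true (p q : ℝ) (h : p + q = 1) (n : ℕ) (A : List ℤ → Prop) (hA : ∀ l, A l) :
    Pr p q n A = 1 := by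
  simp [Pr, hA, Ex_one p q h]

/-- lower bound profile -/
noncomputable def Qf (p q r : ℝ) : ℕ → ℤ → ℝ
  | 0, _ => 1
  | j+1, x => (2*q)^j * (p * g0 r (x+1) + q * g0 r (x-1))

lemma lower (p q r : ℝ) (hp : 0 < p) (hq0 : 0 < q) (hq : q < 1/2) (hpq : p + q = 1)
    (hr : p * r = q) (n : ℕ) : ∀ (j : ℕ) (x : ℤ),
    Qf p q r j x - (2*p*q + 1/2)^n * (2*q)^x ≤ Pr p q n (fun l => j ≤ vis 0 x l) := by
  have hβ : 0 < 2*q := by linarith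
  have hr0 : 0 ≤ r := by
    by_contra hc
    push Not at hc
    nlinarith
  have hr2 : r ≤ 2 * q := by nlinarith
  induction n with
  | zero =>
    intro j x
    cases j with
    | zero =>
      rw [Pr_true p q hpq _ _ (fun l => Nat.zero_le _)]
      have : 0 < (2*q)^x := zpow_pos hβ x
      simp only [Qf]; simp; linarith
    | succ j =>
      have e : Pr p q 0 (fun l => j + 1 ≤ vis 0 x l) = 0 := by simp [Pr, Ex, vis]
      rw [e]
      have h1 := g0_sup p q r hpq hr hq x
      have h2 : g0 r x ≤ (2*q)^x := by
        rcases le_or_gt x 0 with h | h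
        · rw [g0_neg r x h]
          obtain ⟨k, rfl⟩ : ∃ k : ℕ, x = -(k:ℤ) := ⟨(-x).toNat, by omega⟩
          rw [zpow_neg, zpow_natCast]
          exact (one_le_inv₀ (by positivity)).2 (pow_le_one₀ hβ.le (by linarith))
        · obtain ⟨k, rfl⟩ : ∃ k : ℕ, x = (k:ℤ) := ⟨x.toNat, by omega⟩
          rw [g0_nat, zpow_natCast]
          exact pow_le_pow_left₀ hr0 hr2 k
      have h3 : (2*q)^j ≤ 1 := pow_le_one₀ hβ.le (by linarith)
      have h4 : 0 ≤ p * g0 r (x+1) + q * g0 r (x-1) :=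
        add_nonneg (mul_nonneg hp.le (g0_nonneg r hr0 _)) (mul_nonneg hq0.le (g0_nonneg r hr0 _))
      have h5 := mul_le_of_le_one_left h4 h3
      simp only [Qf, pow_zero, one_mul]
      linarith
  | succ n ih =>
    intro j x
    cases j with
    | zero =>
      rw [Pr_true p q hpq _ _ (fun l => Nat.zero_le _)]
      have : 0 < (2*q)^x := zpow_pos hβ x
      have h2 : 0 < (2*p*q+1/2)^(n+1) := by positivity
      simp only [Qf]; nlinarith
    | succ j =>
      rw [Pr_succ]
      have key : ∀ z : ℤ, (2*q)^j * g0 r z - (2*p*q+1/2)^n * (2*q)^z ≤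
          Pr p q n (fun l => j + 1 ≤ (if z = 0 then 1 else 0) + vis 0 z l) := by
        intro z
        by_cases hz : z = 0
        · subst hz
          have := ih j 0
          have e : Qf p q r j 0 = (2*q)^j * g0 r 0 := by
            rw [g0_neg r 0 le_rfl]
            cases j with
            | zero => simp [Qf]
            | succ j => simp only [Qf, g0_zero p q r hr]; ring
          rw [e] at this
          have e2 : (fun l => j + 1 ≤ (if (0:ℤ) = 0 then 1 else 0) + vis 0 0 l) =
              (fun l => j ≤ vis 0 0 l) := by
            funext l
            simp only [if_true, eq_iff_iff]
            omega
          rw [e2]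
          exact this
        · have := ih (j+1) z
          simp only [Qf, g0_harm p q r hpq hr z hz] at this
          simpa [hz] using this
      have k1 := mul_le_mul_of_nonneg_left (key (x+1)) hp.le
      have k2 := mul_le_mul_of_nonneg_left (key (x+(-1))) hq0.le
      simp only [vis]
      refine le_trans (le_of_eq ?_) (add_le_add k1 k2)
      have z1 : (2*q)^(x+1) = (2*q)^x * (2*q) := zpow_add_one₀ hβ.ne' x
      have z2 : (2*q)^(x+(-1)) = (2*q)^x * (2*q)⁻¹ := zpow_sub_one₀ hβ.ne' x
      rw [z1, z2]
      have z3 : q * (2*q)⁻¹ = 1/2 := by field_simp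
      simp only [Qf, ← sub_eq_add_neg]
      linear_combination (2*p*q+1/2)^n * (2*q)^x * z3

lemma block (p q π : ℝ) (hp : 0 ≤ p) (hq0 : 0 ≤ q) (hpq : p + q = 1) (L j : ℕ)
    (hπ1 : π ≤ 1) (hπ : π ≤ Pr p q L (fun l => j ≤ vis 0 0 l)) (K : ℕ) : ∀ x : ℤ,
    Pr p q (L*K) (fun l => ∀ z, vis z x l < j) ≤ (1-π)^K := by
  induction K with
  | zero =>
    intro x
    simp only [mul_zero, Pr, Ex, pow_zero]
    split_ifs <;> norm_num
  | succ K ih =>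
    intro x
    rw [show L * (K+1) = L + L * K by ring]
    unfold Pr
    rw [Ex_append]
    classical
    have h1 : ∀ l : List ℤ, Ex p q (L*K) (fun l' => if ∀ z, vis z x (l ++ l') < j then (1:ℝ) else 0) ≤
        (1-π)^K * (1 - (if j ≤ vis 0 0 l then (1:ℝ) else 0)) := by
      intro l
      have e : vis 0 0 l = vis x x l := by have := vis_shift 0 x l 0; simpa using this.symm
      by_cases hl : j ≤ vis 0 0 l
      · rw [if_pos hl, sub_self, mul_zero]
        have : ∀ l', ¬ ∀ z, vis z x (l ++ l') < j := by
          intro l' hc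
          have := hc x
          rw [vis_append] at this
          omega
        simp only [this, if_false]
        have h := Ex_mul p q 0 (L*K) (fun _ => 1)
        simp only [zero_mul] at h
        exact h.le
      · rw [if_neg hl, sub_zero, mul_one]
        refine le_trans ?_ (ih (x + l.sum))
        unfold Pr
        apply Ex_mono p q hp hq0
        intro l'
        split_ifs with h2 h3 h3
        · exact le_rfl
        · exact absurd (fun z => lt_of_le_of_lt (by rw [vis_append]; omega) (h2 z)) h3
        · norm_num
        · exact le_rfl
    have h2 := Ex_mono p q hp hq0 L _ _ h1
    rw [Ex_mul, Ex_sub, Ex_one p q hpq] at h2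
    have h3 : Ex p q L (fun l => if j ≤ vis 0 0 l then (1:ℝ) else 0) = Pr p q L (fun l => j ≤ vis 0 0 l) := by
      unfold Pr
      congr 1
      funext l
      congr 1
    rw [h3] at h2
    have h4 : (1-π)^K * (1 - Pr p q L (fun l => j ≤ vis 0 0 l)) ≤ (1-π)^(K+1) := by
      rw [pow_succ]
      exact mul_le_mul_of_nonneg_left (by linarith) (pow_nonneg (by linarith) _)
    refine le_trans (le_of_eq ?_) (h2.trans h4)
    congr 1

/-! ## Assembly -/

lemma params (p q r : ℝ) (hq0 : 0 < q) (hq : q < 1/2) (hpq : p + q = 1) (hr : p * r = q) :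
    ∃ δ s u : ℝ, 0 < δ ∧ 1 ≤ s ∧ 1 ≤ u ∧ s * (1 + 2*q + δ) ≤ 2 + δ ∧
      u * (r + 2*q + δ) ≤ 1 + r + δ ∧ 1 < (2*q) * (s * u) := by
  have hp : 1/2 < p := by linarith
  have hr0 : 0 < r := by
    by_contra hc
    push Not at hc
    nlinarith
  have hr1 : r < 1 := by nlinarith
  have hr2 : r < 2 * q := by nlinarith
  set D := (1-2*q)*(2*q-r) with hD
  have hDpos : 0 < D := mul_pos (by linarith) (by linarith)
  have hD1 : D ≤ 1 := by nlinarith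
  set δ := D/20 with hδ
  have hδ0 : 0 < δ := by positivity
  have hδ1 : δ ≤ 1 := by linarith
  refine ⟨δ, (2+δ)/(1+2*q+δ), (1+r+δ)/(r+2*q+δ), hδ0, ?_, ?_, ?_, ?_, ?_⟩
  · rw [one_le_div (by positivity)]; linarith
  · rw [one_le_div (by positivity)]; linarith
  · rw [div_mul_cancel₀ _ (by positivity)]
  · rw [div_mul_cancel₀ _ (by positivity)]
  · rw [div_mul_div_comm, ← mul_div_assoc, one_lt_div (by positivity)]
    have e : 2*q*((2+δ)*(1+r+δ)) - (1+2*q+δ)*(r+2*q+δ) =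
      D + δ * (2*q*(3+r) - (1+r+4*q)) - δ^2 * (1-2*q) := by rw [hD]; ring
    have h1 : -4 ≤ 2*q*(3+r) - (1+r+4*q) := by nlinarith
    have h2 : δ^2 * (1-2*q) ≤ δ := by nlinarith
    have h3 : -4 * δ ≤ δ * (2*q*(3+r) - (1+r+4*q)) := by nlinarith
    linarith

lemma fail_bound (p q r : ℝ) (hq0 : 0 < q) (hq : q < 1/2) (hpq : p + q = 1) (hr : p * r = q)
    (C0 : ℕ) (hC0 : (2*p*q+1/2)^C0 ≤ q) (m K : ℕ) (hK : 2*((m:ℝ)+1)/(2*q)^(m+1) ≤ K) :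
    Pr p q (C0*(m+1)*K) (fun l => ∀ z, vis z 0 l < m+1) ≤ (Real.exp (-1))^(m+1) := by
  have hp : 0 < p := by linarith
  have hpos : 0 < (2*q)^(m+1) := by positivity
  have h1 := lower p q r hp hq0 hq hpq hr (C0*(m+1)) (m+1) 0
  have h2 : (2*q)^(m+1)/2 ≤ Pr p q (C0*(m+1)) (fun l => m+1 ≤ vis 0 0 l) := by
    refine le_trans ?_ h1
    simp only [Qf, g0_zero p q r hr, zpow_zero, mul_one]
    have h3 : (2*p*q+1/2)^(C0*(m+1)) ≤ (2*q)^(m+1)/2 := by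
      rw [pow_mul]
      calc ((2*p*q+1/2)^C0)^(m+1) ≤ q^(m+1) := pow_le_pow_left₀ (by positivity) hC0 _
        _ ≤ (2*q)^(m+1)/2 := by
          rw [mul_pow, pow_succ 2 m]
          have : (1:ℝ) ≤ 2^m := one_le_pow₀ (by norm_num)
          have h4 : 0 < q^(m+1) := by positivity
          nlinarith
    have : (2*q)^m * (2*q) = (2*q)^(m+1) := by ring
    linarith
  have hle1 : (2*q)^(m+1)/2 ≤ 1 := by
    have : (2*q)^(m+1) ≤ 1 := pow_le_one₀ (by linarith) (by linarith)
    linarith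
  refine (block p q _ hp.le hq0.le hpq _ _ hle1 h2 K 0).trans ?_
  have h5 : 1 - (2*q)^(m+1)/2 ≤ Real.exp (-((2*q)^(m+1)/2)) := Real.one_sub_le_exp_neg _
  refine (pow_le_pow_left₀ (by linarith) h5 K).trans ?_
  rw [← Real.exp_nat_mul, ← Real.exp_nat_mul, Real.exp_le_exp]
  rw [div_le_iff₀ hpos] at hK
  push_cast
  nlinarith

lemma pair_num (q w Cst : ℝ) (hq0 : 0 < q) (hq : q < 1/2) (hw : 0 < w) (hC : 0 ≤ Cst)
    (C0 m : ℕ) (hC1 : 1 ≤ C0) (K : ℕ) (hK : (K:ℝ) ≤ 2*((m:ℝ)+1)/(2*q)^(m+1) + 1) :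
    (2 * ((C0*(m+1)*K : ℕ) : ℝ) + 1) * m * (Cst * (w⁻¹)^m) ≤
      (7 * C0 * Cst / (2*q)) * (((m+1:ℕ):ℝ)^3 * ((2*q*w)⁻¹)^m) := by
  have hpos : 0 < (2*q)^(m+1) := by positivity
  have hle : (2*q)^(m+1) ≤ 1 := pow_le_one₀ (by linarith) (by linarith)
  have hC1' : (1:ℝ) ≤ C0 := by exact_mod_cast hC1
  have hm : (0:ℝ) ≤ m := by positivity
  have a1 : (1:ℝ) ≤ ((m:ℝ)+1)/(2*q)^(m+1) := by rw [one_le_div hpos]; linarith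
  set Y := ((m:ℝ)+1)/(2*q)^(m+1) with hY
  have hK' : (K:ℝ) ≤ 3 * Y := by
    have : 2*((m:ℝ)+1)/(2*q)^(m+1) = 2 * Y := by rw [hY]; ring
    linarith
  have hz : (1:ℝ) ≤ C0 * (m+1) := by nlinarith
  have a2 : 2 * ((C0*(m+1)*K : ℕ) : ℝ) + 1 ≤ 7 * (C0 * (m+1) * Y) := by
    push_cast
    have : (C0:ℝ)*(m+1)*K ≤ C0*(m+1)*(3*Y) := mul_le_mul_of_nonneg_left hK' (by positivity)
    nlinarith
  have hw' : 0 ≤ Cst * (w⁻¹)^m := by positivity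
  calc (2 * ((C0*(m+1)*K : ℕ) : ℝ) + 1) * m * (Cst * (w⁻¹)^m)
      ≤ (7 * (C0 * (m+1) * Y)) * (m+1) * (Cst * (w⁻¹)^m) := by
        apply mul_le_mul_of_nonneg_right _ hw'
        exact mul_le_mul a2 (by linarith) hm (by positivity)
    _ = _ := by
        simp only [hY, mul_inv, mul_pow, inv_pow, pow_succ]
        push_cast
        field_simp

lemma sum_aux (t D : ℝ) (ht0 : 0 < t) (ht1 : t < 1) :
    Summable (fun m : ℕ => D * (((m+1:ℕ):ℝ)^3 * t^m)) := by
  apply Summable.mul_left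
  have h := summable_pow_mul_geometric_of_norm_lt_one 3 (r := t)
    (by rw [Real.norm_eq_abs, abs_of_pos ht0]; exact ht1)
  have h2 := ((summable_nat_add_iff 1).2 h).mul_left t⁻¹
  refine h2.congr (fun m => ?_)
  rw [pow_succ t m]; field_simp

/-- Almost surely, there is `M ≥ 1` such that for all `m > M` and all `k ≥ 2`,
the event `C_m^k` occurs if and only if `B_m^k` occurs. -/
theorem C_eq_B_eventually
    [MeasurableSpace Ω] (P : Measure Ω) [IsProbabilityMeasure P]
    (X : ℕ → Ω → ℤ) (p q : ℝ) (hq0 : 0 < q) (hq : q < 1/2) (hpq : p + q = 1)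
    (hX : IsAsymmetricSRW P X p q) :
    ∀ᵐ ω ∂P, ∃ M : ℕ, 1 ≤ M ∧ ∀ m : ℕ, M < m → ∀ k : ℕ, 2 ≤ k →
      (ω ∈ Cevent X m k ↔ ω ∈ Bevent X m k) := by
  have hp : 0 < p := by linarith
  obtain ⟨r, hr⟩ : ∃ r, p * r = q := ⟨q/p, by field_simp⟩
  have hr0 : 0 ≤ r := by
    by_contra hc
    push Not at hc
    nlinarith
  have hr1 : r ≤ 1 := by nlinarith
  obtain ⟨δ, s, u, hδ, hs, hu, hs2, hu2, hsu⟩ := params p q r hq0 hq hpq hr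
  have hsu1 : 0 < s * u := by positivity
  have hlam : 2*p*q+1/2 < 1 := by nlinarith [sq_nonneg (p-q), mul_pos (show 0 < p - q by linarith) (show 0 < p - q by linarith)]
  obtain ⟨C1, hC1⟩ := exists_pow_lt_of_lt_one hq0 hlam
  obtain ⟨C0, hC01, hC0⟩ : ∃ C0 : ℕ, 1 ≤ C0 ∧ (2*p*q+1/2)^C0 ≤ q :=
    ⟨C1+1, by omega, (pow_le_pow_of_le_one (by positivity) hlam.le (Nat.le_succ C1)).trans hC1.le⟩
  let K : ℕ → ℕ := fun m => ⌈2*((m:ℝ)+1)/(2*q)^(m+1)⌉₊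
  let N : ℕ → ℕ := fun m => C0*(m+1)*K m
  have hK1 : ∀ m : ℕ, 2*((m:ℝ)+1)/(2*q)^(m+1) ≤ K m := fun m => Nat.le_ceil _
  have hK2 : ∀ m : ℕ, (K m : ℝ) ≤ 2*((m:ℝ)+1)/(2*q)^(m+1) + 1 := fun m =>
    (Nat.ceil_lt_add_one (by positivity)).le
  let Fl : ℕ → Set Ω := fun m => {ω | ∀ z, vis z 0 (lst X (N m) ω) < m+1}
  let Pa : ℕ → Set Ω := fun m => ⋃ a ∈ Finset.Icc (-(N m : ℤ)) (N m), ⋃ d ∈ Finset.Icc 1 m,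
    {ω | m ≤ vis a 0 (lst X (N m) ω) ∧ m ≤ vis (a + (d:ℤ)) 0 (lst X (N m) ω)}
  set Cst := s * u * (2 + δ) / δ with hCst
  have hCst0 : 0 ≤ Cst := by positivity
  have hFl : ∑' m, P (Fl m) ≠ ∞ := by
    have hb : ∀ m, P (Fl m) ≤ ENNReal.ofReal ((Real.exp (-1))^(m+1)) := by
      intro m
      have := P_eq_Pr P p q hp.le hq0.le hpq (N m) X hX (fun l => ∀ z, vis z 0 l < m+1)
      show P {ω | ∀ z, vis z 0 (lst X (N m) ω) < m+1} ≤ _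
      rw [this]
      exact ENNReal.ofReal_le_ofReal (fail_bound p q r hq0 hq hpq hr C0 hC0 m (K m) (hK1 m))
    have hsum : Summable (fun m : ℕ => (Real.exp (-1))^(m+1)) :=
      (summable_nat_add_iff 1).2 (summable_geometric_of_lt_one (Real.exp_pos _).le
        (by rw [Real.exp_lt_one_iff]; norm_num))
    exact ne_top_of_le_ne_top hsum.tsum_ofReal_ne_top (ENNReal.tsum_le_tsum hb)
  have hPa : ∑' m, P (Pa m) ≠ ∞ := by
    have hb : ∀ m, P (Pa m) ≤ ENNReal.ofReal
        ((7 * C0 * Cst / (2*q)) * (((m+1:ℕ):ℝ)^3 * ((2*q*(s*u))⁻¹)^m)) := by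
      intro m
      have h1 : ∀ a : ℤ, ∀ d ∈ Finset.Icc 1 m,
          P {ω | m ≤ vis a 0 (lst X (N m) ω) ∧ m ≤ vis (a + (d:ℤ)) 0 (lst X (N m) ω)} ≤
            ENNReal.ofReal (Cst * ((s*u)⁻¹)^m) := by
        intro a d hd
        rw [Finset.mem_Icc] at hd
        rw [P_eq_Pr P p q hp.le hq0.le hpq (N m) X hX
          (fun l => m ≤ vis a 0 l ∧ m ≤ vis (a + (d:ℤ)) 0 l)]
        exact ENNReal.ofReal_le_ofReal (two_site_Pr p q r δ s u hp.le hq0.le hq hpq hr hr0 hr1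
          hδ hs hu hs2 hu2 a (a+d) (by omega) (N m) m)
      have h2 : P (Pa m) ≤ ∑ a ∈ Finset.Icc (-(N m : ℤ)) (N m), ∑ d ∈ Finset.Icc 1 m,
          ENNReal.ofReal (Cst * ((s*u)⁻¹)^m) := by
        refine (measure_biUnion_finset_le _ _).trans (Finset.sum_le_sum fun a _ => ?_)
        exact (measure_biUnion_finset_le _ _).trans (Finset.sum_le_sum fun d hd => h1 a d hd)
      refine h2.trans ?_
      simp only [Finset.sum_const, Int.card_Icc, Nat.card_Icc, Nat.add_sub_cancel, nsmul_eq_mul]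
      have e : ((N m : ℤ) + 1 - -(N m : ℤ)).toNat = 2 * N m + 1 := by omega
      rw [e, ← ENNReal.ofReal_natCast, ← ENNReal.ofReal_natCast, ← ENNReal.ofReal_mul (by positivity),
        ← ENNReal.ofReal_mul (by positivity)]
      apply ENNReal.ofReal_le_ofReal
      have := pair_num q (s*u) Cst hq0 hq hsu1 hCst0 C0 m hC01 (K m) (hK2 m)
      refine le_trans (le_of_eq ?_) this
      simp only [N]
      push_cast
      ring
    have hsum := sum_aux ((2*q*(s*u))⁻¹) (7 * C0 * Cst / (2*q)) (by positivity) (inv_lt_one_of_one_lt₀ hsu)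
    exact ne_top_of_le_ne_top hsum.tsum_ofReal_ne_top (ENNReal.tsum_le_tsum hb)
  have hpm : ∀ᵐ ω ∂P, ∀ i, X i ω = 1 ∨ X i ω = -1 :=
    ae_all_iff.2 fun i => srw_pm hp.le hq0.le hpq hX i
  filter_upwards [hpm, ae_eventually_notMem hFl, ae_eventually_notMem hPa] with ω hω h1 h2
  have habs : ∀ i, |X i ω| ≤ 1 := fun i => by rcases hω i with h | h <;> simp [h]
  obtain ⟨M, hM⟩ := eventually_atTop.1 (h1.and h2)
  refine ⟨M + 1, by omega, fun m hm k hk => ⟨C_imp_B X m (by omega) ω k, ?_⟩⟩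
  obtain ⟨hF, hA⟩ := hM m (by omega)
  apply B_imp_C X m (by omega) ω habs (N m) _ _ k (by omega)
  · by_contra hc
    push Not at hc
    exact hF (fun z => by rw [← lt_eq_vis]; exact hc z)
  · intro a b hab hb ha hb'
    apply hA
    have habs' := abs_le.1 (lt_pos_abs X ω habs a (N m) (by omega))
    simp only [Pa, mem_iUnion]
    refine ⟨a, Finset.mem_Icc.2 habs', (b-a).toNat, Finset.mem_Icc.2 ⟨by omega, by omega⟩, ?_⟩
    show m ≤ vis a 0 (lst X (N m) ω) ∧ m ≤ vis (a + ((b-a).toNat:ℤ)) 0 (lst X (N m) ω)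
    rw [show a + ((b-a).toNat:ℤ) = b by omega, ← lt_eq_vis, ← lt_eq_vis]
    exact ⟨ha, hb'⟩
end
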